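/- arXiv:1210.4487 — 5 statements merged into one kernel-verified Lean document; each statement's English description precedes it below -/
import Mathlib

section
/- Let A be a nonnegative vector in ℝⁿ with k strictly positive entries, D = A₁+⋯+Aₙ+n, and B₁* = B₁(0) ∩ ℝⁿ_*. With weighted perimeter P and measure m as above, P(B₁*)/m(B₁*)^{(D-1)/D} = 2^{-k/D} · P(B₁)/m(B₁)^{(D-1)/D}; in particular, when A ≠ 0 the full ball B₁ has strictly larger weighted isoperimetric quotient than B₁*. -/
open MeasureTheory

noncomputable def qbW {n : ℕ} (A : Fin n → ℝ) (x : EuclideanSpace ℝ (Fin n)) : ℝ := ∏ i, |x i| ^ A i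

noncomputable def qbR {n : ℕ} (j : Fin n) : EuclideanSpace ℝ (Fin n) ≃ₗᵢ[ℝ] EuclideanSpace ℝ (Fin n) :=
  LinearIsometryEquiv.piLpCongrRight 2
    (fun i => if i = j then LinearIsometryEquiv.neg ℝ else LinearIsometryEquiv.refl ℝ ℝ)

lemma qbR_apply {n : ℕ} (j i : Fin n) (x : EuclideanSpace ℝ (Fin n)) :
    qbR j x i = if i = j then - x i else x i := by
  simp only [qbR, LinearIsometryEquiv.piLpCongrRight_apply]
  split_ifs <;> simp_all

lemma qbW_R {n : ℕ} (A : Fin n → ℝ) (j : Fin n) (x) : qbW A (qbR j x) = qbW A x := by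
  unfold qbW
  refine Finset.prod_congr rfl fun i _ => ?_
  rw [qbR_apply]; split_ifs <;> simp

lemma qbW_cont {n : ℕ} (A : Fin n → ℝ) (hA : ∀ i, 0 ≤ A i) : Continuous (qbW A) := by
  unfold qbW
  refine continuous_finsetProd _ fun i _ => ?_
  exact Continuous.rpow_const (by fun_prop) (fun _ => Or.inr (hA i))

lemma qbW_nonneg {n : ℕ} (A : Fin n → ℝ) (x) : 0 ≤ qbW A x :=
  Finset.prod_nonneg fun i _ => Real.rpow_nonneg (abs_nonneg _) _

lemma qbW_le_one {n : ℕ} (A : Fin n → ℝ) (hA : ∀ i, 0 ≤ A i) (x) (hx : ‖x‖ ≤ 1) : qbW A x ≤ 1 := by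
  refine Finset.prod_le_one (fun i _ => Real.rpow_nonneg (abs_nonneg _) _) fun i _ => ?_
  exact Real.rpow_le_one (abs_nonneg _) ((PiLp.norm_apply_le x i).trans hx) (hA i)

lemma qbW_zero {n : ℕ} (A : Fin n → ℝ) (j : Fin n) (hj : 0 < A j) (x : EuclideanSpace ℝ (Fin n))
    (hx : x j = 0) : qbW A x = 0 := by
  refine Finset.prod_eq_zero (Finset.mem_univ j) ?_
  rw [hx, abs_zero, Real.zero_rpow hj.ne']

lemma qb_sym {n : ℕ} (A : Fin n → ℝ)
    (μ : Measure (EuclideanSpace ℝ (Fin n))) (hμ : ∀ j, MeasurePreserving (qbR j) μ μ)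
    (s : Set (EuclideanSpace ℝ (Fin n))) (hs : MeasurableSet s) (hR : ∀ j x, qbR j x ∈ s ↔ x ∈ s)
    (hint : IntegrableOn (qbW A) s μ) (S : Finset (Fin n)) (hS : ∀ i ∈ S, 0 < A i) :
    ∫ x in s, qbW A x ∂μ = 2 ^ S.card * ∫ x in s ∩ {x | ∀ i ∈ S, 0 < x i}, qbW A x ∂μ := by
  classical
  induction S using Finset.induction_on with
  | empty => simp
  | insert j S hj ih =>
    rw [ih (fun i hi => hS i (Finset.mem_insert_of_mem hi)), Finset.card_insert_of_notMem hj,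
      pow_succ, mul_assoc]
    congr 1
    set T := s ∩ {x : EuclideanSpace ℝ (Fin n) | ∀ i ∈ S, 0 < x i} with hT
    have hpos : MeasurableSet {x : EuclideanSpace ℝ (Fin n) | 0 < x j} :=
      measurableSet_lt (by fun_prop) (by fun_prop)
    have hT' : s ∩ {x : EuclideanSpace ℝ (Fin n) | ∀ i ∈ insert j S, 0 < x i}
        = T ∩ {x | 0 < x j} := by
      ext x; simp [hT]; tauto
    have hTm : MeasurableSet T := by
      refine hs.inter ?_
      have : {x : EuclideanSpace ℝ (Fin n) | ∀ i ∈ S, 0 < x i} = ⋂ i ∈ S, {x | 0 < x i} := by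
        ext; simp
      rw [this]
      exact Finset.measurableSet_biInter _ fun i _ =>
        measurableSet_lt (by fun_prop) (by fun_prop)
    rw [hT', ← integral_inter_add_sdiff hpos (hint.mono_set Set.inter_subset_left), two_mul]
    congr 1
    have h1 : ∫ x in T \ {x | 0 < x j}, qbW A x ∂μ = ∫ x in T ∩ {x | x j < 0}, qbW A x ∂μ := by
      refine setIntegral_eq_of_subset_of_forall_sdiff_eq_zero (hTm.diff hpos) ?_ ?_
      · rintro x ⟨h1, h2⟩
        exact ⟨h1, fun h3 => lt_asymm (show x j < 0 from h2) h3⟩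
      · rintro x ⟨⟨h1, h2⟩, h3⟩
        refine qbW_zero A j (hS j (Finset.mem_insert_self _ _)) x ?_
        by_contra h
        rcases lt_or_gt_of_ne h with h | h
        · exact h3 ⟨h1, h⟩
        · exact h2 h
    rw [h1, ← (hμ j).setIntegral_preimage_emb (qbR j).toHomeomorph.measurableEmbedding]
    have h2 : qbR j ⁻¹' (T ∩ {x | x j < 0}) = T ∩ {x | 0 < x j} := by
      ext x
      simp only [hT, Set.mem_preimage, Set.mem_inter_iff, hR, Set.mem_ofPred_eq, qbR_apply, if_true,
        neg_lt_zero]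
      refine and_congr_left fun _ => and_congr_right fun _ => forall₂_congr fun i hi => ?_
      have hij : i ≠ j := by
        rintro rfl
        exact hj hi
      rw [if_neg hij]
    rw [h2]
    simp [qbW_R]

noncomputable def qbF {m : ℕ} (i : Fin (m+1)) (s : ℝ) (y : Fin m → ℝ) : EuclideanSpace ℝ (Fin (m+1)) :=
  WithLp.toLp 2 (i.insertNth s y)

lemma qbF_ne {m : ℕ} (i : Fin (m+1)) (s : ℝ) (hs : s ≠ 0) (y : Fin m → ℝ) : qbF i s y ≠ 0 := by
  intro h
  have := congrArg (fun x : EuclideanSpace ℝ (Fin (m+1)) => x i) h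
  simp [qbF] at this
  exact hs this

lemma qbF_contDiff {m : ℕ} (i : Fin (m+1)) (s : ℝ) : ContDiff ℝ 1 (qbF (m := m) i s) := by
  rw [contDiff_piLp]
  intro j
  rcases Fin.eq_self_or_eq_succAbove i j with rfl | ⟨k, rfl⟩
  · simp [qbF]; exact contDiff_const
  · simp [qbF]; fun_prop

lemma qb_finite (m : ℕ) :
    μH[(m:ℝ)] (Metric.sphere (0 : EuclideanSpace ℝ (Fin (m+1))) 1) < ⊤ := by
  let K : Set (Fin m → ℝ) := Metric.closedBall 0 1
  let g (i : Fin (m+1)) (s : ℝ) (y : Fin m → ℝ) := ‖qbF i s y‖⁻¹ • qbF i s y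
  have hfin : ∀ i s, s ≠ 0 → μH[(m:ℝ)] (g i s '' K) < ⊤ := by
    intro i s hs
    have hc : ContDiff ℝ 1 (g i s) := by
      refine ContDiff.smul (ContDiff.inv (𝕜 := ℝ) (𝕜' := ℝ) ?_ ?_) (qbF_contDiff i s)
      · exact (qbF_contDiff i s).norm ℝ (qbF_ne i s hs)
      · intro y; exact norm_ne_zero_iff.2 (qbF_ne i s hs y)
    obtain ⟨C, hC⟩ := (hc.contDiffOn (s := K)).exists_lipschitzOnWith one_ne_zero
      (convex_closedBall _ _) (isCompact_closedBall _ _)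
    refine (hC.hausdorffMeasure_image_le (Nat.cast_nonneg m)).trans_lt ?_
    have : (μH[(m:ℝ)] : Measure (Fin m → ℝ)) = volume := by
      simpa using hausdorffMeasure_pi_real (ι := Fin m)
    rw [this]
    refine ENNReal.mul_lt_top ?_ (isCompact_closedBall _ _).measure_lt_top
    exact ENNReal.rpow_lt_top_of_nonneg (Nat.cast_nonneg m) ENNReal.coe_ne_top
  have hsub : Metric.sphere (0 : EuclideanSpace ℝ (Fin (m+1))) 1 ⊆
      ⋃ i : Fin (m+1), (g i 1 '' K ∪ g i (-1) '' K) := by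
    intro x hx
    have hx1 : ‖x‖ = 1 := by simpa using hx
    obtain ⟨i, -, hi⟩ := Finset.exists_max_image Finset.univ (fun i => |x i|) Finset.univ_nonempty
    have hi0 : x i ≠ 0 := by
      intro h0
      have : x = 0 := by
        ext j
        have := hi j (Finset.mem_univ _)
        rw [h0, abs_zero] at this
        exact abs_nonpos_iff.1 this
      rw [this] at hx1; simp at hx1
    have hpos : 0 < |x i| := abs_pos.2 hi0
    have key : ∀ s : ℝ, s * |x i| = x i → x ∈ g i s '' K := by
      intro s hs
      refine ⟨fun k => x (i.succAbove k) / |x i|, ?_, ?_⟩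
      · simp only [K, mem_closedBall_zero_iff]
        refine (pi_norm_le_iff_of_nonneg zero_le_one).2 fun k => ?_
        rw [Real.norm_eq_abs, abs_div, abs_abs, div_le_one hpos]
        exact hi _ (Finset.mem_univ _)
      · have : qbF i s (fun k => x (i.succAbove k) / |x i|) = |x i|⁻¹ • x := by
          ext j
          rcases Fin.eq_self_or_eq_succAbove i j with rfl | ⟨k, rfl⟩
          · simp [qbF]; field_simp; exact hs
          · simp [qbF]; field_simp
        simp only [g, this]
        rw [norm_smul, hx1, smul_smul]
        simp [hpos.ne']
    refine Set.mem_iUnion.2 ⟨i, ?_⟩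
    rcases lt_or_gt_of_ne hi0 with h | h
    · right; exact key _ (by rw [abs_of_neg h]; ring)
    · left; exact key _ (by rw [abs_of_pos h]; ring)
  refine (measure_mono hsub).trans_lt ?_
  refine (measure_iUnion_le _).trans_lt ?_
  rw [tsum_fintype]
  refine ENNReal.sum_lt_top.2 fun i _ => ?_
  exact measure_union_lt_top (hfin i 1 one_ne_zero) (hfin i (-1) (by norm_num))

lemma qb_pos (m : ℕ) :
    0 < μH[(m:ℝ)] (Metric.sphere (0 : EuclideanSpace ℝ (Fin (m+1))) 1 ∩ {x | ∀ i, 0 < x i}) := by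
  let p : EuclideanSpace ℝ (Fin (m+1)) → (Fin m → ℝ) := fun x k => x k.succ
  have hp : LipschitzWith 1 p := by
    refine LipschitzWith.of_dist_le_mul fun x y => ?_
    rw [NNReal.coe_one, one_mul, dist_pi_le_iff dist_nonneg]
    intro k
    rw [Real.dist_eq, dist_eq_norm]
    exact PiLp.norm_apply_le (x - y) k.succ
  let U : Set (Fin m → ℝ) := {y | (∀ k, 0 < y k) ∧ ∑ k, y k ^ 2 < 1}
  have hU : IsOpen U := by
    have h2 : IsOpen {y : Fin m → ℝ | ∑ k, y k ^ 2 < 1} := isOpen_lt (by fun_prop) (by fun_prop)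
    refine IsOpen.inter (s := {y : Fin m → ℝ | ∀ k, 0 < y k}) ?_ h2
    simp only [Set.ofPred_forall]
    exact isOpen_iInter_of_finite fun k => isOpen_lt (by fun_prop) (by fun_prop)
  have hUn : U.Nonempty := by
    refine ⟨fun _ => 1 / (m + 1 : ℝ), fun k => by positivity, ?_⟩
    simp only [Finset.sum_const, Finset.card_univ, Fintype.card_fin, nsmul_eq_mul]
    rw [div_pow, one_pow, mul_one_div, div_lt_one (by positivity)]
    nlinarith [(Nat.cast_nonneg m : (0:ℝ) ≤ m)]
  have hsub : U ⊆ p '' (Metric.sphere (0 : EuclideanSpace ℝ (Fin (m+1))) 1 ∩ {x | ∀ i, 0 < x i}) := by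
    rintro y ⟨hy, hy1⟩
    refine ⟨WithLp.toLp 2 (Fin.cons (√(1 - ∑ k, y k ^ 2)) y), ⟨?_, ?_⟩, ?_⟩
    · rw [mem_sphere_zero_iff_norm, EuclideanSpace.norm_eq, Real.sqrt_eq_one, Fin.sum_univ_succ]
      simp only [Real.norm_eq_abs, sq_abs, Fin.cons_zero, Fin.cons_succ]
      rw [Real.sq_sqrt (by linarith)]; ring
    · intro i
      refine Fin.cases ?_ (fun k => ?_) i
      · simpa using hy1
      · simpa using hy k
    · ext k; simp [p]
  have h1 := hp.hausdorffMeasure_image_le (Nat.cast_nonneg (α := ℝ) m)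
    (Metric.sphere (0 : EuclideanSpace ℝ (Fin (m+1))) 1 ∩ {x | ∀ i, 0 < x i})
  have : (μH[(m:ℝ)] : Measure (Fin m → ℝ)) = volume := by
    simpa using hausdorffMeasure_pi_real (ι := Fin m)
  rw [this] at h1
  have h2 := (hU.measure_pos volume hUn).trans_le ((measure_mono hsub).trans h1)
  simpa using h2

lemma qb_frontier {n : ℕ} (A : Fin n → ℝ) (x : EuclideanSpace ℝ (Fin n)) :
    (x ∈ Metric.sphere (0 : EuclideanSpace ℝ (Fin n)) 1 ∩ {x | ∀ i, 0 < A i → 0 < x i} →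
      x ∈ frontier (Metric.ball (0 : EuclideanSpace ℝ (Fin n)) 1 ∩ {x | ∀ i, 0 < A i → 0 < x i})) ∧
    (x ∈ frontier (Metric.ball (0 : EuclideanSpace ℝ (Fin n)) 1 ∩ {x | ∀ i, 0 < A i → 0 < x i}) →
      x ∉ Metric.sphere (0 : EuclideanSpace ℝ (Fin n)) 1 ∩ {x | ∀ i, 0 < A i → 0 < x i} →
      qbW A x = 0) := by
  have hRo : IsOpen {x : EuclideanSpace ℝ (Fin n) | ∀ i, 0 < A i → 0 < x i} := by
    simp only [Set.ofPred_forall]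
    exact isOpen_iInter_of_finite fun i => isOpen_iInter_of_finite fun _ =>
      isOpen_lt (by fun_prop) (by fun_prop)
  rw [(Metric.isOpen_ball.inter hRo).frontier_eq]
  constructor
  · rintro ⟨hx, hx'⟩
    have hx1 : ‖x‖ = 1 := by simpa using hx
    refine ⟨?_, fun h => ?_⟩
    · have ht : Filter.Tendsto (fun t : ℝ => t • x) (nhdsWithin 1 (Set.Iio 1)) (nhds x) := by
        have : Filter.Tendsto (fun t : ℝ => t • x) (nhds 1) (nhds ((1:ℝ) • x)) :=
          (Continuous.tendsto (by fun_prop) _)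
        rw [one_smul] at this
        exact this.mono_left nhdsWithin_le_nhds
      refine mem_closure_of_tendsto ht ?_
      filter_upwards [Ioo_mem_nhdsLT (show (0:ℝ) < 1 by norm_num)] with t ht
      refine ⟨?_, fun i hi => ?_⟩
      · rw [mem_ball_zero_iff, norm_smul, hx1, mul_one, Real.norm_eq_abs, abs_of_pos ht.1]
        exact ht.2
      · exact mul_pos ht.1 (hx' i hi)
    · have := h.1
      rw [mem_ball_zero_iff, hx1] at this
      exact lt_irrefl _ this
  · rintro ⟨hc, hn⟩ hns
    by_contra hW
    have hcl : x ∈ Metric.closedBall (0 : EuclideanSpace ℝ (Fin n)) 1 ∩ {x | ∀ i, 0 < A i → 0 ≤ x i} := by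
      refine closure_minimal ?_ ?_ hc
      · rintro y ⟨h1, h2⟩
        exact ⟨Metric.ball_subset_closedBall h1, fun i hi => (h2 i hi).le⟩
      · refine Metric.isClosed_closedBall.inter ?_
        simp only [Set.ofPred_forall]
        exact isClosed_iInter fun i => isClosed_iInter fun _ =>
          isClosed_le (by fun_prop) (by fun_prop)
    have hR : ∀ i, 0 < A i → 0 < x i := fun i hi =>
      lt_of_le_of_ne (hcl.2 i hi) fun h => hW (qbW_zero A i hi x h.symm)
    have h1 : ‖x‖ ≤ 1 := by simpa using hcl.1
    rcases h1.lt_or_eq with h | h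
    · exact hn ⟨by simpa using h, hR⟩
    · exact hns ⟨by simpa using h, hR⟩

/-- Relation between the weighted isoperimetric quotients of the full unit ball `B₁`
and of `B₁* = B₁ ∩ ℝⁿ_*`; in particular the full ball is not a minimizer when `A ≠ 0`. -/
theorem quotient_ball_vs_quarter_ball (n : ℕ) (A : Fin n → ℝ) (hA : ∀ i, 0 ≤ A i)
    (D : ℝ) (hD : D = (∑ i, A i) + n)
    (k : ℕ) (hk : k = (Finset.univ.filter (fun i => 0 < A i)).card)
    (Rstar : Set (EuclideanSpace ℝ (Fin n)))
    (hRstar : Rstar = {x | ∀ i, 0 < A i → 0 < x i})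
    (B₁star : Set (EuclideanSpace ℝ (Fin n)))
    (hB : B₁star = Metric.ball 0 1 ∩ Rstar) :
    (∫ x in frontier B₁star, ∏ i, |x i| ^ A i ∂(μH[(n : ℝ) - 1]))
        / (∫ x in B₁star, ∏ i, |x i| ^ A i) ^ ((D - 1) / D)
      = (2 : ℝ) ^ (-(k : ℝ) / D) *
        ((∫ x in frontier (Metric.ball (0 : EuclideanSpace ℝ (Fin n)) 1),
            ∏ i, |x i| ^ A i ∂(μH[(n : ℝ) - 1]))
          / (∫ x in Metric.ball (0 : EuclideanSpace ℝ (Fin n)) 1,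
              ∏ i, |x i| ^ A i) ^ ((D - 1) / D))
    ∧ (A ≠ 0 →
      (∫ x in frontier B₁star, ∏ i, |x i| ^ A i ∂(μH[(n : ℝ) - 1]))
          / (∫ x in B₁star, ∏ i, |x i| ^ A i) ^ ((D - 1) / D)
        < (∫ x in frontier (Metric.ball (0 : EuclideanSpace ℝ (Fin n)) 1),
            ∏ i, |x i| ^ A i ∂(μH[(n : ℝ) - 1]))
          / (∫ x in Metric.ball (0 : EuclideanSpace ℝ (Fin n)) 1,
              ∏ i, |x i| ^ A i) ^ ((D - 1) / D)) := by
  by_cases hA0 : A = 0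
  · subst hA0
    have hk0 : k = 0 := by simp [hk]
    have hBB : B₁star = Metric.ball 0 1 := by simp [hB, hRstar]
    refine ⟨?_, fun h => absurd rfl h⟩
    rw [hBB, hk0]; simp
  obtain ⟨j, hj⟩ : ∃ j, 0 < A j := by
    by_contra! h
    exact hA0 (funext fun i => le_antisymm (h i) (hA i))
  obtain ⟨m, rfl⟩ : ∃ m, n = m + 1 := ⟨n - 1, by have := j.2; omega⟩
  have hdim : ((m + 1 : ℕ) : ℝ) - 1 = (m : ℝ) := by push_cast; ring
  rw [hdim, frontier_ball _ one_ne_zero]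
  subst hRstar
  subst hB
  have hkpos : 0 < k := by
    rw [hk, Finset.card_pos]; exact ⟨j, by simpa using hj⟩
  have hDpos : 0 < D := by
    rw [hD]
    have := Finset.sum_nonneg (fun i (_ : i ∈ Finset.univ) => hA i)
    push_cast; positivity
  change (∫ x in _, qbW A x ∂_) / (∫ x in _, qbW A x) ^ _ = _ * ((∫ x in _, qbW A x ∂_) / (∫ x in _, qbW A x) ^ _)
    ∧ (_ → (∫ x in _, qbW A x ∂_) / (∫ x in _, qbW A x) ^ _ < ((∫ x in _, qbW A x ∂_) / (∫ x in _, qbW A x) ^ _))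
  set S := Finset.univ.filter (fun i => 0 < A i) with hSdef
  have hS : ∀ i ∈ S, 0 < A i := by simp [hSdef]
  have hSR : {x : EuclideanSpace ℝ (Fin (m+1)) | ∀ i ∈ S, 0 < x i} = {x | ∀ i, 0 < A i → 0 < x i} := by
    ext x; simp [hSdef]
  have hint : IntegrableOn (qbW A) (Metric.sphere 0 1) μH[(m:ℝ)] := by
    refine Measure.integrableOn_of_bounded (M := 1) (qb_finite m).ne
      (qbW_cont A hA).aestronglyMeasurable ?_
    refine (ae_restrict_iff' Metric.isClosed_sphere.measurableSet).2 (.of_forall fun x hx => ?_)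
    rw [Real.norm_eq_abs, abs_of_nonneg (qbW_nonneg A x)]
    exact qbW_le_one A hA x (by simpa using (mem_sphere_zero_iff_norm.1 hx).le)
  have hintB : IntegrableOn (qbW A) (Metric.ball 0 1) volume :=
    ((qbW_cont A hA).continuousOn.integrableOn_compact (isCompact_closedBall 0 1)).mono_set
      Metric.ball_subset_closedBall
  have hP := qb_sym A μH[(m:ℝ)] (fun j => (qbR j).toIsometryEquiv.measurePreserving_hausdorffMeasure _)
    (Metric.sphere 0 1) Metric.isClosed_sphere.measurableSet (fun j x => by simp) hint S hS
  have hM := qb_sym A volume (fun j => (qbR j).measurePreserving)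
    (Metric.ball 0 1) Metric.isOpen_ball.measurableSet (fun j x => by simp) hintB S hS
  rw [hSR, ← hk] at hP hM
  have hF : ∫ x in frontier (Metric.ball (0 : EuclideanSpace ℝ (Fin (m+1))) 1 ∩ {x | ∀ i, 0 < A i → 0 < x i}),
      qbW A x ∂μH[(m:ℝ)] = ∫ x in Metric.sphere 0 1 ∩ {x | ∀ i, 0 < A i → 0 < x i}, qbW A x ∂μH[(m:ℝ)] :=
    setIntegral_eq_of_subset_of_forall_sdiff_eq_zero isClosed_frontier.measurableSet
      (fun x hx => (qb_frontier A x).1 hx) (fun x hx => (qb_frontier A x).2 hx.1 hx.2)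
  have hPpos : 0 < ∫ x in Metric.sphere 0 1, qbW A x ∂μH[(m:ℝ)] := by
    rw [setIntegral_pos_iff_support_of_nonneg_ae (.of_forall (qbW_nonneg A)) hint]
    refine (qb_pos m).trans_le (measure_mono ?_)
    rintro x ⟨h1, h2⟩
    refine ⟨?_, h1⟩
    exact (Finset.prod_pos fun i _ => Real.rpow_pos_of_pos (abs_pos.2 (h2 i).ne') _).ne'
  have hMpos : 0 < ∫ x in Metric.ball 0 1, qbW A x := by
    rw [setIntegral_pos_iff_support_of_nonneg_ae (.of_forall (qbW_nonneg A)) hintB]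
    have ho : IsOpen (Function.support (qbW A) ∩ Metric.ball 0 1) :=
      ((qbW_cont A hA).isOpen_support).inter Metric.isOpen_ball
    refine ho.measure_pos _ ⟨WithLp.toLp 2 (fun _ => 1 / (m + 2 : ℝ)), ?_, ?_⟩
    · exact (Finset.prod_pos fun i _ => Real.rpow_pos_of_pos (abs_pos.2 (by simp; positivity)) _).ne'
    · rw [mem_ball_zero_iff, EuclideanSpace.norm_eq, Real.sqrt_lt' one_pos]
      simp only [Finset.sum_const, Finset.card_univ, Fintype.card_fin, nsmul_eq_mul, Real.norm_eq_abs, sq_abs]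
      rw [div_pow, one_pow, mul_one_div, div_lt_one (by positivity)]
      push_cast
      nlinarith [(Nat.cast_nonneg m : (0:ℝ) ≤ m)]
  rw [hF]
  rw [hP] at hPpos ⊢
  rw [hM] at hMpos ⊢
  generalize (∫ x in Metric.sphere 0 1 ∩ {x | ∀ i, 0 < A i → 0 < x i}, qbW A x ∂μH[(m:ℝ)]) = P at *
  generalize (∫ x in Metric.ball 0 1 ∩ {x | ∀ i, 0 < A i → 0 < x i}, qbW A x) = M at *
  have h2k : (0:ℝ) < 2 ^ k := by positivity
  have hP0 : 0 < P := pos_of_mul_pos_right hPpos h2k.le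
  have hM0 : 0 < M := pos_of_mul_pos_right hMpos h2k.le
  have hMr : 0 < M ^ ((D - 1) / D) := Real.rpow_pos_of_pos hM0 _
  have e : P / M ^ ((D - 1) / D) = (2:ℝ) ^ (-(k:ℝ)/D) * (2 ^ k * P / (2 ^ k * M) ^ ((D-1)/D)) := by
    rw [Real.mul_rpow h2k.le hM0.le, ← Real.rpow_natCast, ← Real.rpow_mul (by norm_num)]
    have h3 : (2:ℝ) ^ (k * ((D-1)/D)) = 2 ^ (-(k:ℝ)/D) * 2 ^ (k:ℝ) := by
      rw [← Real.rpow_add (by norm_num)]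
      congr 1; field_simp; ring
    rw [h3]
    have : (0:ℝ) < 2 ^ (-(k:ℝ)/D) := by positivity
    have : (0:ℝ) < 2 ^ (k:ℝ) := by positivity
    field_simp
  refine ⟨e, fun _ => ?_⟩
  rw [e]
  refine mul_lt_of_lt_one_left (by positivity) ?_
  refine Real.rpow_lt_one_of_one_lt_of_neg (by norm_num) ?_
  rw [neg_div, neg_lt_zero]
  positivity
end

section
/- Let A be a nonnegative vector in ℝⁿ, D = A₁+⋯+Aₙ+n, and 1 ≤ p < D a real number, p* = pD/(D−p). Then there is a constant C such that for every C¹ function u on ℝⁿ with compact support, (∫_{ℝⁿ_*} x^A |u|^{p*} dx)^{1/p*} ≤ C (∫_{ℝⁿ_*} x^A |∇u|^p dx)^{1/p}, where x^A = |x₁|^{A₁}⋯|xₙ|^{Aₙ} and ℝⁿ_* = {x : xᵢ > 0 whenever Aᵢ > 0}. -/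
open MeasureTheory

open scoped ENNReal

namespace WSob

def Sset (a : ℝ) : Set ℝ := {t | 0 < a → 0 < t}

lemma Sset_meas (a : ℝ) : MeasurableSet (Sset a) := by
  by_cases h : 0 < a
  · have : Sset a = Set.Ioi 0 := by ext t; simp [Sset, h]
    rw [this]; exact measurableSet_Ioi
  · have : Sset a = Set.univ := by ext t; simp [Sset, h]
    rw [this]; exact MeasurableSet.univ

noncomputable def nu (a : ℝ) : Measure ℝ :=
  (volume.restrict (Sset a)).withDensity (fun t => ENNReal.ofReal (|t| ^ a))

instance (a : ℝ) : SigmaFinite (nu a) :=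
  SigmaFinite.withDensity_of_ne_top (by simp)

lemma meas_w (a : ℝ) : Measurable (fun t : ℝ => ENNReal.ofReal (|t| ^ a)) := by fun_prop

lemma one_dim {a : ℝ} (ha : 0 ≤ a) {φ : ℝ → ℝ} (hφ : ContDiff ℝ 1 φ) (h2 : HasCompactSupport φ)
    {s : ℝ} (hs : s ∈ Sset a) :
    ENNReal.ofReal (|s| ^ a) * ‖φ s‖ₑ ≤ ∫⁻ t, ‖deriv φ t‖ₑ ∂(nu a) := by
  have key : ‖φ s‖ₑ ≤ ∫⁻ t in Set.Ioi s, ‖deriv φ t‖ₑ := by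
    have e : ∫ t in Set.Ioi s, deriv φ t = - φ s := by
      rw [integral_Ioi_of_hasDerivAt_of_tendsto (m := 0) (f := φ)
        hφ.continuous.continuousWithinAt
        (fun x _ => (hφ.differentiable one_ne_zero x).hasDerivAt)
        ((hφ.continuous_deriv le_rfl).integrable_of_hasCompactSupport h2.deriv).integrableOn]
      · simp
      · rw [hasCompactSupport_iff_eventuallyEq, Filter.coclosedCompact_eq_cocompact] at h2
        exact (h2.filter_mono _root_.atTop_le_cocompact).tendsto
    have := enorm_integral_le_lintegral_enorm (μ := volume.restrict (Set.Ioi s)) (deriv φ)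
    rwa [e, enorm_neg] at this
  have hc : Measurable fun t => ‖deriv φ t‖ₑ := (hφ.continuous_deriv le_rfl).enorm.measurable
  rw [nu, lintegral_withDensity_eq_lintegral_mul _ (meas_w a) hc]
  calc _ ≤ ENNReal.ofReal (|s| ^ a) * ∫⁻ t in Set.Ioi s, ‖deriv φ t‖ₑ := by gcongr
    _ = ∫⁻ t in Set.Ioi s, ENNReal.ofReal (|s| ^ a) * ‖deriv φ t‖ₑ := by
        rw [lintegral_const_mul _ hc]
    _ ≤ ∫⁻ t in Set.Ioi s, ENNReal.ofReal (|t| ^ a) * ‖deriv φ t‖ₑ := by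
        apply setLIntegral_mono' measurableSet_Ioi
        intro t ht
        gcongr ?_ * _
        apply ENNReal.ofReal_le_ofReal
        rcases ha.eq_or_lt with h | h
        · simp [← h]
        · have h0 := hs h
          have ht' : s < t := ht
          apply Real.rpow_le_rpow (abs_nonneg _) _ ha
          rw [abs_of_pos h0, abs_of_pos (h0.trans ht')]; exact ht'.le
    _ ≤ _ := by
        apply lintegral_mono_set
        intro t ht h
        exact (hs h).trans ht

variable {n : ℕ}

lemma piece1 (A : Fin n → ℝ) {F : (Fin n → ℝ) → ℝ≥0∞} (hF : Measurable F)
    {E : Set (Fin n → ℝ)} (hE : MeasurableSet E) (i : Fin n)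
    (h : ∀ x ∈ E, ENNReal.ofReal (|x i| ^ A i) ≤ ∫⁻ s, F (Function.update x i s) ∂(nu (A i)))
    (r : ℝ) :
    Measure.pi (fun i => nu (A i)) (E ∩ {x | |x i| < r}) ≤
      ENNReal.ofReal (2 * r) * ∫⁻ x, F x ∂(Measure.pi (fun i => nu (A i))) := by
  have hm : MeasurableSet (E ∩ {x | |x i| < r}) :=
    hE.inter (measurableSet_lt (by fun_prop) (by fun_prop))
  rw [← lintegral_const_mul _ hF, ← lintegral_indicator_one hm]
  refine lintegral_le_of_lmarginal_le {i} (measurable_one.indicator hm) (hF.const_mul _) ?_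
  rw [lmarginal_singleton, lmarginal_singleton]
  intro x
  dsimp only
  have hFu : Measurable fun s => F (Function.update x i s) := hF.comp (measurable_update x)
  rw [lintegral_const_mul _ hFu]
  set g := ∫⁻ s, F (Function.update x i s) ∂(nu (A i)) with hg
  have hmi : Measurable fun s => (E ∩ {x | |x i| < r}).indicator (1 : (Fin n → ℝ) → ℝ≥0∞)
      (Function.update x i s) := (measurable_one.indicator hm).comp (measurable_update x)
  rw [nu, lintegral_withDensity_eq_lintegral_mul _ (meas_w _) hmi]
  calc _ ≤ ∫⁻ s, (Set.Ioo (-r) r).indicator (fun _ => g) s := by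
        refine (lintegral_mono' Measure.restrict_le_self le_rfl).trans (lintegral_mono ?_)
        intro s
        simp only [Pi.mul_apply]
        by_cases hs : Function.update x i s ∈ E ∩ {x | |x i| < r}
        · rw [Set.indicator_of_mem hs]
          have h1 := h _ hs.1
          have h2 : |s| < r := by simpa using hs.2
          have h3 : s ∈ Set.Ioo (-r) r := abs_lt.1 h2
          rw [Set.indicator_of_mem h3]
          simpa using h1
        · rw [Set.indicator_of_notMem hs]; simp
    _ = ENNReal.ofReal (2 * r) * g := by
        rw [lintegral_indicator measurableSet_Ioo, setLIntegral_const, Real.volume_Ioo, mul_comm]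
        congr 2; ring

lemma piece2 (hn : 2 ≤ n) (A : Fin n → ℝ) (hA : ∀ i, 0 ≤ A i)
    {F : (Fin n → ℝ) → ℝ≥0∞} (hF : Measurable F)
    {E : Set (Fin n → ℝ)} (hE : MeasurableSet E)
    (h : ∀ x ∈ E, ∀ i, ENNReal.ofReal (|x i| ^ A i) ≤
      ∫⁻ s, F (Function.update x i s) ∂(nu (A i)))
    {r : ℝ} (hr : 0 < r) :
    ENNReal.ofReal (r ^ ((∑ i, A i) / (n - 1))) *
    Measure.pi (fun i => nu (A i)) (E ∩ {x | ∀ i, r ≤ |x i|}) ≤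
      (∫⁻ x, F x ∂(Measure.pi (fun i => nu (A i)))) ^ ((n : ℝ) / (n - 1)) := by
  have hn' : (2 : ℝ) ≤ n := by exact_mod_cast hn
  have hm : MeasurableSet (E ∩ {x | ∀ i, r ≤ |x i|}) := by
    refine hE.inter ?_
    rw [Set.ofPred_forall]
    exact MeasurableSet.iInter fun i => measurableSet_le (by fun_prop) (by fun_prop)
  have hp : Real.HolderConjugate (Fintype.card (Fin n)) ((n : ℝ) / (n - 1)) := by
    rw [Fintype.card_fin, Real.holderConjugate_iff]
    refine ⟨by linarith, ?_⟩
    field_simp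
    ring
  have := lintegral_prod_lintegral_pow_le (fun i => nu (A i)) hp hF
  rw [Fintype.card_fin] at this
  refine le_trans ?_ this
  rw [← lintegral_indicator_one hm, ← lintegral_const_mul _ (measurable_one.indicator hm)]
  apply lintegral_mono
  intro x
  dsimp only
  by_cases hx : x ∈ E ∩ {x | ∀ i, r ≤ |x i|}
  · rw [Set.indicator_of_mem hx, Pi.one_apply, mul_one]
    have e : ENNReal.ofReal (r ^ ((∑ i, A i) / (n - 1))) =
        ∏ i, (ENNReal.ofReal (r ^ A i)) ^ ((1 : ℝ) / (n - 1)) := by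
      have : ∀ i, (ENNReal.ofReal (r ^ A i)) ^ ((1 : ℝ) / (n - 1)) =
          ENNReal.ofReal (r ^ (A i / (n - 1))) := by
        intro i
        rw [ENNReal.ofReal_rpow_of_pos (by positivity), ← Real.rpow_mul hr.le]
        congr 2; ring
      simp_rw [this]
      rw [← ENNReal.ofReal_prod_of_nonneg (fun i _ => by positivity),
        ← Real.rpow_sum_of_pos hr, Finset.sum_div]
    rw [e]
    gcongr with i
    · apply div_nonneg <;> linarith
    · refine le_trans ?_ (h x hx.1 i)
      gcongr
      · exact hA i
      · exact hx.2 i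
  · rw [Set.indicator_of_notMem hx]; simp

lemma weak_pi (A : Fin n → ℝ) (hA : ∀ i, 0 ≤ A i) {D : ℝ} (hD : D = (∑ i, A i) + n)
    (hD1 : 1 < D) :
    ∃ K : ℝ≥0∞, K ≠ ⊤ ∧ ∀ (F : (Fin n → ℝ) → ℝ≥0∞), Measurable F →
    ∀ E : Set (Fin n → ℝ), MeasurableSet E →
    (∀ x ∈ E, ∀ i, ENNReal.ofReal (|x i| ^ A i) ≤
      ∫⁻ s, F (Function.update x i s) ∂(nu (A i))) →
    Measure.pi (fun i => nu (A i)) E ≤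
      K * (∫⁻ x, F x ∂(Measure.pi (fun i => nu (A i)))) ^ (D / (D - 1)) := by
  have hDpos : 0 < D / (D - 1) := by apply div_pos <;> linarith
  have hcov : ∀ (E : Set (Fin n → ℝ)) (r : ℝ), E ⊆ (⋃ i, (E ∩ {x | |x i| < r})) ∪
      (E ∩ {x | ∀ i, r ≤ |x i|}) := by
    intro E r x hx
    by_cases h : ∀ i, r ≤ |x i|
    · exact Or.inr ⟨hx, h⟩
    · push Not at h
      obtain ⟨i, hi⟩ := h
      exact Or.inl (Set.mem_iUnion.2 ⟨i, hx, hi⟩)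
  have step : ∀ (F : (Fin n → ℝ) → ℝ≥0∞), Measurable F →
    ∀ E : Set (Fin n → ℝ), MeasurableSet E →
    (∀ x ∈ E, ∀ i, ENNReal.ofReal (|x i| ^ A i) ≤
      ∫⁻ s, F (Function.update x i s) ∂(nu (A i))) → ∀ r : ℝ, 
      Measure.pi (fun i => nu (A i)) E ≤ n * (ENNReal.ofReal (2 * r) *
        ∫⁻ x, F x ∂(Measure.pi (fun i => nu (A i)))) +
        Measure.pi (fun i => nu (A i)) (E ∩ {x | ∀ i, r ≤ |x i|}) := by
    intro F hF E hE h r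
    refine (measure_mono (hcov E r)).trans ((measure_union_le _ _).trans ?_)
    gcongr
    refine (measure_iUnion_fintype_le _ _).trans ?_
    refine (Finset.sum_le_sum fun i _ => piece1 A hF hE i (fun x hx => h x hx i) r).trans ?_
    simp
  rcases Nat.lt_or_ge n 2 with hn | hn
  · have hn1 : n = 1 := by
      interval_cases n
      · simp at hD; linarith
      · rfl
    subst hn1
    simp only [Fin.sum_univ_one, Nat.cast_one] at hD
    set a := A 0 with ha
    have ha0 : 0 < a := by linarith
    refine ⟨ENNReal.ofReal (2 * 2 ^ (1/a)), ENNReal.ofReal_ne_top, ?_⟩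
    intro F hF E hE h
    have hs := step F hF E hE h
    set G := ∫⁻ x, F x ∂(Measure.pi (fun i => nu (A i))) with hG
    have hGi : ∀ x : Fin 1 → ℝ, ∫⁻ s, F (Function.update x 0 s) ∂(nu (A 0)) = G := by
      intro x
      rw [hG, lintegral_eq_lmarginal_univ x]
      have : (Finset.univ : Finset (Fin 1)) = {0} := rfl
      rw [this, lmarginal_singleton]
    have hE' : ∀ r : ℝ, 0 < r → G < ENNReal.ofReal (r ^ a) → (E ∩ {x | ∀ i, r ≤ |x i|}) = ∅ := by
      intro r hr hlt
      ext x
      simp only [Set.mem_inter_iff, Set.mem_ofPred_eq, Set.mem_empty_iff_false, iff_false, not_and]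
      intro hx hr2
      have h1 := h x hx 0
      rw [hGi] at h1
      refine absurd (h1.trans_lt hlt) (not_lt.2 ?_)
      apply ENNReal.ofReal_le_ofReal
      exact Real.rpow_le_rpow hr.le (hr2 0) ha0.le
    rcases eq_or_ne G ⊤ with hGt | hGt
    · rw [hGt, ENNReal.top_rpow_of_pos hDpos, ENNReal.mul_top]
      · exact le_top
      · simp; positivity
    rcases eq_or_ne G 0 with hG0 | hG0
    · have := hs 1
      rw [hE' 1 one_pos (by simp [hG0]), hG0] at this
      simp only [mul_zero, measure_empty, add_zero] at this
      exact this.trans zero_le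
    have hGp : 0 < G.toReal := ENNReal.toReal_pos hG0 hGt
    have hGe : G = ENNReal.ofReal G.toReal := (ENNReal.ofReal_toReal hGt).symm
    set γ := G.toReal
    have := hs ((2 * γ) ^ (1 / a))
    rw [hE' _ (by positivity)] at this
    · simp only [Nat.cast_one, one_mul, measure_empty, add_zero] at this
      refine this.trans_eq ?_
      rw [hGe, ENNReal.ofReal_rpow_of_pos hGp, ← ENNReal.ofReal_mul (by positivity),
        ← ENNReal.ofReal_mul (by positivity)]
      congr 1
      have : D / (D - 1) = 1 / a + 1 := by
        rw [hD, add_sub_cancel_right]; field_simp; ring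
      rw [this, Real.rpow_add hGp, Real.mul_rpow (by norm_num) hGp.le, Real.rpow_one]
      ring
    · rw [hGe, ← Real.rpow_mul (by positivity), one_div, inv_mul_cancel₀ ha0.ne', Real.rpow_one,
        ENNReal.ofReal_lt_ofReal_iff (by positivity)]
      linarith
  · have hn' : (2 : ℝ) ≤ n := by exact_mod_cast hn
    refine ⟨ENNReal.ofReal (2 * n + 1), by simp, ?_⟩
    intro F hF E hE h
    have hs := step F hF E hE h
    have h2 := fun r hr => piece2 hn A hA hF hE h (r := r) hr
    set G := ∫⁻ x, F x ∂(Measure.pi (fun i => nu (A i))) with hG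
    rcases eq_or_ne G ⊤ with hGt | hGt
    · rw [hGt, ENNReal.top_rpow_of_pos hDpos, ENNReal.mul_top]
      · exact le_top
      · simp; positivity
    rcases eq_or_ne G 0 with hG0 | hG0
    · have h1 := hs 1
      have h2 := h2 1 one_pos
      rw [hG0, ENNReal.zero_rpow_of_pos (div_pos (by linarith) (by linarith))] at h2
      simp only [Real.one_rpow, ENNReal.ofReal_one, one_mul, nonpos_iff_eq_zero] at h2
      rw [h2, hG0] at h1
      simp only [mul_zero, add_zero] at h1
      exact h1.trans zero_le
    have hGp : 0 < G.toReal := ENNReal.toReal_pos hG0 hGt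
    have hGe : G = ENNReal.ofReal G.toReal := (ENNReal.ofReal_toReal hGt).symm
    set γ := G.toReal
    have h1 := hs (γ ^ (1 / (D - 1)))
    have h3 := h2 (γ ^ (1 / (D - 1))) (by positivity)
    set M := Measure.pi (fun i => nu (A i)) (E ∩ {x | ∀ i, γ ^ (1 / (D - 1)) ≤ |x i|})
    have hM : M ≤ ENNReal.ofReal (γ ^ (D / (D - 1))) := by
      rw [mul_comm, ← ENNReal.le_div_iff_mul_le (Or.inl (by simp; positivity)) (Or.inl (by simp))] at h3
      refine h3.trans_eq ?_
      rw [hGe, ENNReal.ofReal_rpow_of_pos hGp, ← ENNReal.ofReal_div_of_pos (by positivity),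
        ← Real.rpow_mul hGp.le, ← Real.rpow_sub hGp]
      congr 2
      have hS : ∑ i, A i = D - n := by linarith
      have : D - 1 ≠ 0 := by linarith
      have : (n : ℝ) - 1 ≠ 0 := by linarith
      rw [hS]; field_simp; ring
    refine h1.trans ((add_le_add_right hM _).trans_eq ?_)
    rw [hGe, ENNReal.ofReal_rpow_of_pos hGp, ← ENNReal.ofReal_mul (by positivity),
        ← ENNReal.ofReal_mul (by positivity), ← ENNReal.ofReal_natCast,
        ← ENNReal.ofReal_mul (by positivity), ← ENNReal.ofReal_add (by positivity) (by positivity)]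
    congr 1
    have : D / (D - 1) = 1 / (D - 1) + 1 := by
      have : D - 1 ≠ 0 := by linarith
      field_simp; ring
    rw [this, Real.rpow_add hGp, Real.rpow_one]
    ring


lemma lmarg_prod (μ : Fin n → Measure ℝ) [∀ i, SigmaFinite (μ i)] (f : Fin n → ℝ → ℝ≥0∞)
    (hf : ∀ i, Measurable (f i)) (s : Finset (Fin n)) (x : Fin n → ℝ) :
    (lmarginal μ s (fun x => ∏ i ∈ s, f i (x i))) x = ∏ i ∈ s, ∫⁻ t, f i t ∂(μ i) := by
  induction s using Finset.induction_on generalizing x with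
  | empty => simp
  | insert i s hi ih =>
    have hm : Measurable (fun x : Fin n → ℝ => ∏ j ∈ insert i s, f j (x j)) :=
      Finset.measurable_fun_prod _ fun j _ => (hf j).comp (measurable_pi_apply j)
    rw [lmarginal_insert' _ hm hi, Finset.prod_insert hi, ← ih x]
    have : (fun x : Fin n → ℝ => ∫⁻ t, ∏ j ∈ insert i s, f j (Function.update x i t j) ∂(μ i)) =
        fun x => (∫⁻ t, f i t ∂(μ i)) * ∏ j ∈ s, f j (x j) := by
      ext x
      rw [← lintegral_mul_const _ (hf i)]
      congr 1; ext t
      rw [Finset.prod_insert hi, Function.update_self]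
      congr 1
      refine Finset.prod_congr rfl fun j hj => ?_
      rw [Function.update_of_ne]
      rintro rfl; exact hi hj
    rw [this]
    simp only [lmarginal]
    rw [lintegral_const_mul]
    have h2 : Measurable (fun x : Fin n → ℝ => ∏ j ∈ s, f j (x j)) :=
      Finset.measurable_fun_prod _ fun j _ => (hf j).comp (measurable_pi_apply j)
    exact h2.comp measurable_updateFinset

lemma pi_nu (A : Fin n → ℝ) : Measure.pi (fun i => nu (A i)) =
    (volume.restrict (Set.univ.pi fun i => Sset (A i))).withDensity
      (fun x : Fin n → ℝ => ∏ i, ENNReal.ofReal (|x i| ^ A i)) := by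
  refine Measure.pi_eq fun s hs => ?_
  rw [withDensity_apply _ (MeasurableSet.univ_pi hs), volume_pi, Measure.restrict_pi_pi,
    Measure.restrict_pi_pi, lintegral_eq_lmarginal_univ 0,
    lmarg_prod _ (fun i t => ENNReal.ofReal (|t| ^ A i)) (fun i => meas_w _)]
  refine Finset.prod_congr rfl fun i _ => ?_
  rw [nu, withDensity_apply _ (hs i)]

abbrev Eu (n : ℕ) := EuclideanSpace ℝ (Fin n)

def Rs (A : Fin n → ℝ) : Set (Eu n) := {x | ∀ i, 0 < A i → 0 < x i}

noncomputable def mE (A : Fin n → ℝ) : Measure (Eu n) :=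
  (volume.restrict (Rs A)).withDensity (fun x => ENNReal.ofReal (∏ i, |x i| ^ A i))

lemma Rs_meas (A : Fin n → ℝ) : MeasurableSet (Rs A) := by
  have : Rs A = (WithLp.ofLp : Eu n → _) ⁻¹' (Set.univ.pi fun i => Sset (A i)) := by
    ext x; simp [Rs, Sset, Set.mem_pi]
  rw [this]
  exact (MeasurableSet.univ_pi fun i => Sset_meas _).preimage (by fun_prop)

lemma meas_wE (A : Fin n → ℝ) : Measurable (fun x : Eu n => ENNReal.ofReal (∏ i, |x i| ^ A i)) := by
  fun_prop

lemma lint_mE (A : Fin n → ℝ) {g : Eu n → ℝ≥0∞} (hg : Measurable g) :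
    ∫⁻ y, g y ∂(mE A) = ∫⁻ x, g (WithLp.toLp 2 x) ∂(Measure.pi (fun i => nu (A i))) := by
  have hm := EuclideanSpace.volume_preserving_symm_measurableEquiv_toLp (Fin n)
  have hg' : Measurable fun x : Fin n → ℝ => g (WithLp.toLp 2 x) := by fun_prop
  rw [pi_nu, mE, lintegral_withDensity_eq_lintegral_mul _ (meas_wE A) hg,
    lintegral_withDensity_eq_lintegral_mul _ (by fun_prop) hg',
    ← lintegral_indicator (Rs_meas A),
    ← lintegral_indicator (MeasurableSet.univ_pi fun i => Sset_meas _)]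
  rw [← (PiLp.volume_preserving_toLp (Fin n)).lintegral_comp_emb
    (MeasurableEquiv.toLp 2 _).measurableEmbedding]
  congr 1; ext x
  have : (WithLp.toLp 2 x ∈ Rs A) ↔ x ∈ (Set.univ.pi fun i => Sset (A i)) := by
    simp [Rs, Sset, Set.mem_pi]
  by_cases hx : x ∈ (Set.univ.pi fun i => Sset (A i))
  · rw [Set.indicator_of_mem hx, Set.indicator_of_mem (this.2 hx)]
    simp only [Pi.mul_apply]
    rw [ENNReal.ofReal_prod_of_nonneg (fun i _ => by positivity)]
  · rw [Set.indicator_of_notMem hx, Set.indicator_of_notMem (mt this.1 hx)]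

lemma weak_E (A : Fin n → ℝ) (hA : ∀ i, 0 ≤ A i) {D : ℝ} (hD : D = (∑ i, A i) + n)
    (hD1 : 1 < D) :
    ∃ K : ℝ≥0∞, K ≠ ⊤ ∧ ∀ (v : Eu n → ℝ), ContDiff ℝ 1 v → HasCompactSupport v →
    mE A {x | 1 ≤ |v x|} ≤ K * (∫⁻ x, ‖fderiv ℝ v x‖ₑ ∂(mE A)) ^ (D / (D - 1)) := by
  obtain ⟨K, hK, h⟩ := weak_pi A hA hD hD1
  refine ⟨K, hK, fun v hv hv2 => ?_⟩
  have hc : Continuous fun x => ‖fderiv ℝ v x‖ₑ := (hv.continuous_fderiv one_ne_zero).enorm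
  have hmE : MeasurableSet {x | 1 ≤ |v x|} :=
    measurableSet_le measurable_const (hv.continuous.abs.measurable)
  set E : Set (Fin n → ℝ) := (WithLp.toLp 2) ⁻¹' {x : Eu n | 1 ≤ |v x|} ∩
    (Set.univ.pi fun i => Sset (A i)) with hE
  have hEm : MeasurableSet E :=
    (hmE.preimage (by fun_prop)).inter (MeasurableSet.univ_pi fun i => Sset_meas _)
  have := h (fun x => ‖fderiv ℝ v (WithLp.toLp 2 x)‖ₑ) (hc.measurable.comp (by fun_prop)) E hEm ?_
  · rw [lint_mE A hc.measurable]
    refine le_trans (le_of_eq ?_) this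
    have hae : ∀ᵐ x ∂(Measure.pi (fun i => nu (A i))), x ∈ Set.univ.pi fun i => Sset (A i) := by
      rw [pi_nu]
      exact (withDensity_absolutelyContinuous _ _).ae_le
        (ae_restrict_mem (MeasurableSet.univ_pi fun i => Sset_meas _))
    rw [← lintegral_indicator_one hmE, lint_mE A (measurable_one.indicator hmE),
      ← lintegral_indicator_one hEm]
    apply lintegral_congr_ae
    filter_upwards [hae] with x hx
    by_cases h1 : WithLp.toLp 2 x ∈ {x : Eu n | 1 ≤ |v x|}
    · rw [Set.indicator_of_mem h1, Set.indicator_of_mem (show x ∈ E from ⟨h1, hx⟩)]; rfl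
    · rw [Set.indicator_of_notMem h1, Set.indicator_of_notMem (fun h : x ∈ E => h1 h.1)]
  · intro x hx i
    have hline : ∀ s, WithLp.toLp 2 (Function.update x i s) =
        WithLp.toLp 2 (Function.update x i 0) + s • (EuclideanSpace.single i (1 : ℝ)) := by
      intro s
      ext j
      by_cases hj : j = i
      · subst hj; simp
      · simp [hj]
    have hd : ∀ s, HasDerivAt (fun s => v (WithLp.toLp 2 (Function.update x i s)))
        (fderiv ℝ v (WithLp.toLp 2 (Function.update x i s)) (EuclideanSpace.single i (1 : ℝ))) s := by
      intro s
      have h1 : HasDerivAt (fun s => WithLp.toLp 2 (Function.update x i s))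
          (EuclideanSpace.single i (1 : ℝ)) s := by
        rw [funext hline]
        simpa using ((hasDerivAt_id s).smul_const (EuclideanSpace.single i (1 : ℝ))).const_add
          (WithLp.toLp 2 (Function.update x i 0))
      exact ((hv.differentiable one_ne_zero _).hasFDerivAt).comp_hasDerivAt s h1
    have hφ : ContDiff ℝ 1 (fun s => v (WithLp.toLp 2 (Function.update x i s))) := by
      have e : (fun s => v (WithLp.toLp 2 (Function.update x i s))) = fun s : ℝ => v
        (WithLp.toLp 2 (Function.update x i 0) + s • (EuclideanSpace.single i (1 : ℝ))) :=
        funext fun s => congrArg v (hline s)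
      rw [e]
      exact hv.comp (by fun_prop)
    have hφ2 : HasCompactSupport (fun s => v (WithLp.toLp 2 (Function.update x i s))) := by
      refine hv2.comp_isClosedEmbedding (g := fun s => WithLp.toLp 2 (Function.update x i s)) ?_
      exact (PiLp.homeomorph 2 _).symm.isClosedEmbedding.comp (isClosedEmbedding_update x i)
    have hxi : x i ∈ Sset (A i) := hx.2 i (Set.mem_univ _)
    have h1 := one_dim (hA i) hφ hφ2 hxi
    simp only [Function.update_eq_self] at h1
    have h2 : (1 : ℝ≥0∞) ≤ ‖v (WithLp.toLp 2 x)‖ₑ := by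
      rw [← ofReal_norm, ENNReal.one_le_ofReal]
      exact hx.1
    calc _ = ENNReal.ofReal (|x i| ^ A i) * 1 := by rw [mul_one]
      _ ≤ _ := by gcongr
      _ ≤ _ := h1
      _ ≤ _ := by
        apply lintegral_mono
        intro s
        dsimp only
        rw [(hd s).deriv]
        refine (ContinuousLinearMap.le_opENorm _ _).trans_eq ?_
        rw [← ofReal_norm (EuclideanSpace.single i (1 : ℝ))]
        simp


lemma exists_cut : ∃ L : ℝ, 0 ≤ L ∧ ∀ c : ℝ, 0 < c → ∃ ψ : ℝ → ℝ, ContDiff ℝ 1 ψ ∧ ψ 0 = 0 ∧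
    (∀ s, 2 * c ≤ |s| → ψ s = 1) ∧ (∀ s, |deriv ψ s| ≤ L / c) ∧
    (∀ s, deriv ψ s ≠ 0 → c ≤ |s| ∧ |s| < 2 * c) := by
  set ψ : ℝ → ℝ := fun s => Real.smoothTransition ((s ^ 2 - 1) / 3) with hψ
  have hψc : ContDiff ℝ 1 ψ := by
    have : ContDiff ℝ 1 Real.smoothTransition := Real.smoothTransition.contDiff
    exact this.comp (by fun_prop)
  have hsupp : ∀ s, deriv ψ s ≠ 0 → 1 ≤ |s| ∧ |s| < 2 := by
    intro s hs
    constructor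
    · by_contra hlt
      push Not at hlt
      apply hs
      apply IsLocalMin.deriv_eq_zero
      refine Filter.Eventually.of_forall fun t => ?_
      have : ψ s = 0 := by
        apply Real.smoothTransition.zero_of_nonpos
        have := (sq_lt_one_iff_abs_lt_one s).2 hlt
        linarith
      rw [this]; exact Real.smoothTransition.nonneg _
    · by_contra hlt
      push Not at hlt
      apply hs
      apply IsLocalMax.deriv_eq_zero
      refine Filter.Eventually.of_forall fun t => ?_
      have : ψ s = 1 := by
        apply Real.smoothTransition.one_of_one_le
        have := sq_abs s
        nlinarith
      rw [this]; exact Real.smoothTransition.le_one _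
  have hcs : HasCompactSupport (deriv ψ) := by
    refine HasCompactSupport.intro (isCompact_closedBall (0 : ℝ) 2) fun s hs => ?_
    by_contra h
    apply hs
    simpa using (hsupp s h).2.le
  obtain ⟨L, hL⟩ := (hψc.continuous_deriv le_rfl).bounded_above_of_compact_support hcs
  refine ⟨L, (norm_nonneg _).trans (hL 0), fun c hc => ?_⟩
  have hder : ∀ s, deriv (fun s => ψ (c⁻¹ * s)) s = c⁻¹ * deriv ψ (c⁻¹ * s) := by
    intro s
    have := deriv_comp_mul_left c⁻¹ ψ s
    simpa using this
  have habs : ∀ s, |c⁻¹ * s| = |s| / c := by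
    intro s; rw [abs_mul, abs_of_pos (inv_pos.2 hc)]; field_simp
  refine ⟨fun s => ψ (c⁻¹ * s), hψc.comp (by fun_prop), ?_, ?_, ?_, ?_⟩
  · simp only [mul_zero, hψ]
    apply Real.smoothTransition.zero_of_nonpos; norm_num
  · intro s hs
    apply Real.smoothTransition.one_of_one_le
    have h1 : 2 ≤ |c⁻¹ * s| := by rw [habs, le_div_iff₀ hc]; exact hs
    have := sq_abs (c⁻¹ * s)
    nlinarith
  · intro s
    rw [hder, abs_mul, abs_of_pos (inv_pos.2 hc), div_eq_inv_mul]
    gcongr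
    exact hL _
  · intro s hs
    rw [hder] at hs
    have := hsupp _ (right_ne_zero_of_mul hs)
    rw [habs, le_div_iff₀ hc, div_lt_iff₀ hc, one_mul] at this
    exact this

lemma strong_one (m : Measure (Eu n)) {a : ℝ} (ha : 1 ≤ a) {K : ℝ≥0∞} (hK : K ≠ ⊤)
    (h : ∀ (v : Eu n → ℝ), ContDiff ℝ 1 v → HasCompactSupport v →
      m {x | 1 ≤ |v x|} ≤ K * (∫⁻ x, ‖fderiv ℝ v x‖ₑ ∂m) ^ a) :
    ∃ K' : ℝ≥0∞, K' ≠ ⊤ ∧ ∀ (v : Eu n → ℝ), ContDiff ℝ 1 v → HasCompactSupport v →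
      ∫⁻ x, ‖v x‖ₑ ^ a ∂m ≤ K' * (∫⁻ x, ‖fderiv ℝ v x‖ₑ ∂m) ^ a := by
  have ha0 : 0 < a := by linarith
  obtain ⟨L, hL0, hL⟩ := exists_cut
  refine ⟨K * ENNReal.ofReal (4 * L) ^ a,
    ENNReal.mul_ne_top hK (ENNReal.rpow_ne_top_of_nonneg ha0.le ENNReal.ofReal_ne_top), fun u hu hu2 => ?_⟩
  set G := ∫⁻ x, ‖fderiv ℝ u x‖ₑ ∂m with hG
  have hcont : Continuous fun x => ‖fderiv ℝ u x‖ₑ := (hu.continuous_fderiv one_ne_zero).enorm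
  set c : ℤ → ℝ := fun k => (2 : ℝ) ^ k with hc
  have hcp : ∀ k, 0 < c k := fun k => by positivity
  set S : ℤ → Set (Eu n) := fun k => {x | c k ≤ |u x| ∧ |u x| < 2 * c k} with hS
  have hSm : ∀ k, MeasurableSet (S k) := fun k =>
    (measurableSet_le measurable_const hu.continuous.abs.measurable).inter
      (measurableSet_lt hu.continuous.abs.measurable measurable_const)
  have hTm : ∀ k, MeasurableSet {x | 2 * c k ≤ |u x|} := fun k =>
    measurableSet_le measurable_const hu.continuous.abs.measurable
  have hSd : Pairwise (Function.onFun Disjoint S) := by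
    have key : ∀ i j, i < j → Disjoint (S i) (S j) := by
      intro i j hij
      rw [Set.disjoint_left]
      rintro x ⟨h1, h2⟩ ⟨h3, h4⟩
      have : 2 * c i ≤ c j := by
        have : c (i + 1) ≤ c j := zpow_le_zpow_right₀ (by norm_num) hij
        have e : c (i + 1) = c i * 2 := zpow_add_one₀ (by norm_num) i
        linarith
      linarith
    intro i j hij
    rcases lt_or_gt_of_ne hij with h | h
    · exact key i j h
    · exact (key j i h).symm
  set Gk : ℤ → ℝ≥0∞ := fun k => ∫⁻ x in S k, ‖fderiv ℝ u x‖ₑ ∂m with hGk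
  have hsum : ∑' k, Gk k ≤ G := by
    rw [hGk, ← lintegral_iUnion hSm hSd]
    exact setLIntegral_le_lintegral _ _
  have hGkG : ∀ k, Gk k ≤ G := fun k => setLIntegral_le_lintegral _ _
  have hsum' : ∑' k, Gk k ^ a ≤ G ^ a := by
    have e : ∀ y : ℝ≥0∞, y ^ a = y * y ^ (a - 1) := by
      intro y
      conv_lhs => rw [show a = 1 + (a - 1) by ring]
      rw [ENNReal.rpow_add_of_nonneg _ _ zero_le_one (by linarith), ENNReal.rpow_one]
    calc ∑' k, Gk k ^ a ≤ ∑' k, Gk k * G ^ (a - 1) := by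
          refine ENNReal.tsum_le_tsum fun k => ?_
          rw [e]
          have := hGkG k
          gcongr
      _ = (∑' k, Gk k) * G ^ (a - 1) := ENNReal.tsum_mul_right
      _ ≤ G * G ^ (a - 1) := by gcongr
      _ = G ^ a := (e G).symm
  have hlev : ∀ k, m {x | 2 * c k ≤ |u x|} ≤ K * (ENNReal.ofReal (L / c k) * Gk k) ^ a := by
    intro k
    obtain ⟨ψ, h1, h2, h3, h4, h5⟩ := hL (c k) (hcp k)
    have hw := h (fun x => ψ (u x)) (h1.comp hu) (hu2.comp_left h2)
    refine le_trans (measure_mono ?_) (hw.trans ?_)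
    · intro x hx
      have : ψ (u x) = 1 := h3 _ hx
      simp [this]
    · gcongr
      rw [hGk, ← lintegral_const_mul _ hcont.measurable, ← lintegral_indicator (hSm k)]
      apply lintegral_mono
      intro x
      have hd : fderiv ℝ (fun x => ψ (u x)) x = deriv ψ (u x) • fderiv ℝ u x :=
        (((h1.differentiable one_ne_zero (u x)).hasDerivAt).comp_hasFDerivAt x
          (hu.differentiable one_ne_zero x).hasFDerivAt).fderiv
      dsimp only
      rw [hd, enorm_smul]
      by_cases h0 : deriv ψ (u x) = 0
      · simp [h0]
      · rw [Set.indicator_of_mem (show x ∈ S k from h5 _ h0)]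
        gcongr
        rw [← ofReal_norm]
        exact ENNReal.ofReal_le_ofReal (h4 _)
  have hpt : ∀ x, ‖u x‖ₑ ^ a ≤ ∑' k, {x | 2 * c k ≤ |u x|}.indicator
      (fun _ => ENNReal.ofReal (4 * c k) ^ a) x := by
    intro x
    by_cases h0 : u x = 0
    · simp [h0, ha0]
    · obtain ⟨k, hk1, hk2⟩ := exists_mem_Ico_zpow (abs_pos.2 h0) (one_lt_two (α := ℝ))
      have e1 : (2 : ℝ) ^ k = 2 * c (k - 1) := by
        rw [hc]; dsimp only; rw [zpow_sub_one₀ (by norm_num)]; ring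
      have e2 : (2 : ℝ) ^ (k + 1) = 4 * c (k - 1) := by
        rw [zpow_add_one₀ (by norm_num), e1]; ring
      refine le_trans ?_ (ENNReal.le_tsum (k - 1))
      rw [Set.indicator_of_mem (show x ∈ {x | 2 * c (k-1) ≤ |u x|} by rw [e1] at hk1; exact hk1)]
      gcongr
      rw [← ofReal_norm, ← e2]
      exact ENNReal.ofReal_le_ofReal hk2.le
  calc ∫⁻ x, ‖u x‖ₑ ^ a ∂m ≤ ∫⁻ x, (∑' k, {x | 2 * c k ≤ |u x|}.indicator
      (fun _ => ENNReal.ofReal (4 * c k) ^ a) x) ∂m := lintegral_mono hpt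
    _ = ∑' k, ENNReal.ofReal (4 * c k) ^ a * m {x | 2 * c k ≤ |u x|} := by
        rw [lintegral_tsum fun k => (measurable_const.indicator (hTm k)).aemeasurable]
        congr 1; ext k
        rw [lintegral_indicator_const (hTm k)]
    _ ≤ ∑' k, K * ENNReal.ofReal (4 * L) ^ a * Gk k ^ a := by
        refine ENNReal.tsum_le_tsum fun k => ?_
        calc _ ≤ ENNReal.ofReal (4 * c k) ^ a * (K * (ENNReal.ofReal (L / c k) * Gk k) ^ a) := by
              gcongr; exact hlev k
          _ = K * (ENNReal.ofReal (4 * c k) * ENNReal.ofReal (L / c k)) ^ a * Gk k ^ a := by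
              rw [ENNReal.mul_rpow_of_nonneg _ _ ha0.le, ENNReal.mul_rpow_of_nonneg _ _ ha0.le]
              ring
          _ = _ := by
              have := hcp k
              rw [← ENNReal.ofReal_mul (by positivity)]
              congr 4
              field_simp
    _ = K * ENNReal.ofReal (4 * L) ^ a * ∑' k, Gk k ^ a := ENNReal.tsum_mul_left
    _ ≤ _ := by gcongr


lemma strong_p (m : Measure (Eu n)) [IsFiniteMeasureOnCompacts m] {D p q : ℝ} (hp : 1 ≤ p)
    (hpD : p < D) (hq : q = p * D / (D - p)) {K : ℝ≥0∞} (hK : K ≠ ⊤)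
    (h : ∀ (v : Eu n → ℝ), ContDiff ℝ 1 v → HasCompactSupport v →
      ∫⁻ x, ‖v x‖ₑ ^ (D / (D - 1)) ∂m ≤ K * (∫⁻ x, ‖fderiv ℝ v x‖ₑ ∂m) ^ (D / (D - 1))) :
    ∃ K' : ℝ≥0∞, K' ≠ ⊤ ∧ ∀ (v : Eu n → ℝ), ContDiff ℝ 1 v → HasCompactSupport v →
      (∫⁻ x, ‖v x‖ₑ ^ q ∂m) ^ (1 / q) ≤ K' * (∫⁻ x, ‖fderiv ℝ v x‖ₑ ^ p ∂m) ^ (1 / p) := by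
  have hDp : 0 < D - p := by linarith
  have hD1 : 0 < D - 1 := by linarith
  have hD0 : 0 < D := by linarith
  have hp0 : 0 < p := by linarith
  have hq0 : 0 < q := by rw [hq]; positivity
  set a := D / (D - 1) with ha
  have ha0 : 0 < a := by positivity
  have root : ∀ X Y : ℝ≥0∞, X ≤ K * Y ^ a → X ^ (1 / a) ≤ K ^ (1 / a) * Y := by
    intro X Y hXY
    have := ENNReal.rpow_le_rpow hXY (show 0 ≤ 1 / a by positivity)
    rwa [ENNReal.mul_rpow_of_nonneg _ _ (by positivity), ← ENNReal.rpow_mul,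
      mul_one_div_cancel ha0.ne', ENNReal.rpow_one] at this
  rcases hp.eq_or_lt with h1 | h1
  · subst h1
    refine ⟨K ^ (1 / a), ENNReal.rpow_ne_top_of_nonneg (by positivity) hK, fun v hv hv2 => ?_⟩
    have : q = a := by rw [hq, one_mul]
    rw [this]
    simpa using root _ _ (h v hv hv2)
  · set γ := q / a with hγ
    have hγv : γ = p * (D - 1) / (D - p) := by rw [hγ, hq, ha]; field_simp
    have hγ1 : 1 < γ := by
      rw [hγv, lt_div_iff₀ hDp]; nlinarith
    have hγ0 : 0 < γ := by linarith
    set p' := p / (p - 1) with hp'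
    have hp10 : 0 < p - 1 := by linarith
    have hconj : p'.HolderConjugate p := by
      have := Real.HolderConjugate.conjExponent h1
      exact this.symm
    have hp'0 : 0 < p' := by positivity
    refine ⟨K ^ (1 / a) * ENNReal.ofReal γ,
      ENNReal.mul_ne_top (ENNReal.rpow_ne_top_of_nonneg (by positivity) hK) (by simp),
      fun u hu hu2 => ?_⟩
    set X := ∫⁻ x, ‖u x‖ₑ ^ q ∂m with hX
    set Y := ∫⁻ x, ‖fderiv ℝ u x‖ₑ ^ p ∂m with hY
    have hXt : X ≠ ⊤ := by
      have hcont : Continuous fun x => ‖u x‖ ^ q :=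
        hu.continuous.norm.rpow_const fun _ => Or.inr hq0.le
      have hcs : HasCompactSupport fun x => ‖u x‖ ^ q :=
        hu2.comp_left (g := fun t : ℝ => ‖t‖ ^ q) (by simp [hq0.ne'])
      have := (hcont.integrable_of_hasCompactSupport (μ := m) hcs).hasFiniteIntegral
      rw [hasFiniteIntegral_iff_enorm] at this
      refine ne_of_lt (lt_of_eq_of_lt ?_ this)
      apply lintegral_congr
      intro x
      rw [Real.enorm_rpow_of_nonneg (norm_nonneg _) hq0.le, enorm_norm]
    have hv := h (fun x => ‖u x‖ ^ γ) (hu.norm_rpow hγ1)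
      (hu2.comp_left (g := fun t : ℝ => ‖t‖ ^ γ) (by simp [hγ0.ne']))
    have e1 : ∫⁻ x, ‖‖u x‖ ^ γ‖ₑ ^ a ∂m = X := by
      apply lintegral_congr
      intro x
      rw [Real.enorm_rpow_of_nonneg (norm_nonneg _) hγ0.le, enorm_norm, ← ENNReal.rpow_mul, hγ,
        div_mul_cancel₀ _ ha0.ne']
    rw [e1] at hv
    have hv := root _ _ hv
    have hold : ∫⁻ x, ‖fderiv ℝ (fun x => ‖u x‖ ^ γ) x‖ₑ ∂m ≤
        ENNReal.ofReal γ * (X ^ (1 / p') * Y ^ (1 / p)) := by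
      calc _ ≤ ∫⁻ x, ENNReal.ofReal γ * (‖u x‖ₑ ^ (γ - 1) * ‖fderiv ℝ u x‖ₑ) ∂m := by
            apply lintegral_mono
            intro x
            have := enorm_fderiv_norm_rpow_le (hu.differentiable one_ne_zero) (x := x)
              (p := ⟨γ, hγ0.le⟩) (by exact_mod_cast hγ1)
            refine this.trans_eq ?_
            rw [mul_assoc]
            congr 1
            rw [ENNReal.ofReal]; congr 1
            exact (Real.toNNReal_of_nonneg hγ0.le).symm
        _ = ENNReal.ofReal γ * ∫⁻ x, (‖u x‖ₑ ^ (γ - 1) * ‖fderiv ℝ u x‖ₑ) ∂m := by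
            rw [lintegral_const_mul]
            exact (hu.continuous.enorm.measurable.pow_const _).mul
              (hu.continuous_fderiv one_ne_zero).enorm.measurable
        _ ≤ _ := by
            gcongr
            have := ENNReal.lintegral_mul_le_Lp_mul_Lq m hconj
              (f := fun x => ‖u x‖ₑ ^ (γ - 1)) (g := fun x => ‖fderiv ℝ u x‖ₑ)
              (hu.continuous.enorm.measurable.pow_const _).aemeasurable
              (hu.continuous_fderiv one_ne_zero).enorm.measurable.aemeasurable
            refine this.trans_eq ?_
            congr 2
            apply lintegral_congr
            intro x
            rw [← ENNReal.rpow_mul]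
            congr 1
            rw [hγv, hp', hq]
            field_simp
            ring
    have hfin : X ^ (1 / a) ≤ (K ^ (1 / a) * ENNReal.ofReal γ * Y ^ (1 / p)) * X ^ (1 / p') := by
      refine hv.trans ((mul_le_mul_right hold _).trans_eq ?_)
      ring
    rcases eq_or_ne X 0 with hX0 | hX0
    · rw [hX0, ENNReal.zero_rpow_of_pos (by positivity)]; exact zero_le
    have ex : 1 / q = 1 / a - 1 / p' := by
      rw [hq, ha, hp']; field_simp; ring
    rw [ex, ENNReal.rpow_sub _ _ hX0 hXt]
    exact ENNReal.div_le_of_le_mul hfin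

end WSob

/-- Sobolev inequality with monomial weight `x^A`. -/
theorem weighted_sobolev_inequality (n : ℕ) (A : Fin n → ℝ) (hA : ∀ i, 0 ≤ A i)
    (D : ℝ) (hD : D = (∑ i, A i) + n)
    (p : ℝ) (hp1 : 1 ≤ p) (hpD : p < D) (pStar : ℝ) (hpStar : pStar = p * D / (D - p))
    (Rstar : Set (EuclideanSpace ℝ (Fin n)))
    (hRstar : Rstar = {x | ∀ i, 0 < A i → 0 < x i}) :
    ∃ C : ℝ, ∀ u : EuclideanSpace ℝ (Fin n) → ℝ, ContDiff ℝ 1 u →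
      HasCompactSupport u →
      (∫ x in Rstar, (∏ i, |x i| ^ A i) * |u x| ^ pStar) ^ (1 / pStar)
        ≤ C * (∫ x in Rstar, (∏ i, |x i| ^ A i) * ‖gradient u x‖ ^ p) ^ (1 / p) := by
  have hD1 : 1 < D := by linarith
  have hDp : 0 < D - p := by linarith
  have hp0 : 0 < p := by linarith
  have hq0 : 0 < pStar := by rw [hpStar]; apply div_pos (mul_pos hp0 (by linarith)) hDp
  have hwc : Continuous fun x : EuclideanSpace ℝ (Fin n) => ∏ i, |x i| ^ A i :=
    continuous_finsetProd _ fun i _ =>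
      (by fun_prop : Continuous fun x : EuclideanSpace ℝ (Fin n) => |x i|).rpow_const
        fun _ => Or.inr (hA i)
  have hwn : ∀ x : EuclideanSpace ℝ (Fin n), 0 ≤ ∏ i, |x i| ^ A i := fun x =>
    Finset.prod_nonneg fun i _ => by positivity
  have hloc : IsFiniteMeasureOnCompacts (WSob.mE A) := by
    refine ⟨fun k hk => ?_⟩
    rw [WSob.mE, withDensity_apply _ hk.measurableSet]
    have h1 : IntegrableOn (fun x : EuclideanSpace ℝ (Fin n) => ∏ i, |x i| ^ A i) k
        (volume.restrict (WSob.Rs A)) :=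
      (hwc.continuousOn.integrableOn_compact hk).mono_measure Measure.restrict_le_self
    exact h1.lintegral_lt_top
  obtain ⟨K, hK, h⟩ := WSob.weak_E A hA hD hD1
  obtain ⟨K, hK, h⟩ := WSob.strong_one (WSob.mE A)
    (by rw [le_div_iff₀ (by linarith)]; linarith) hK h
  obtain ⟨K, hK, h⟩ := WSob.strong_p (WSob.mE A) hp1 hpD hpStar hK h
  have hR : Rstar = WSob.Rs A := hRstar
  have conv : ∀ (f : EuclideanSpace ℝ (Fin n) → ℝ), Continuous f → (∀ x, 0 ≤ f x) → ∀ q : ℝ, 0 < q →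
      ∫ x in Rstar, (∏ i, |x i| ^ A i) * f x ^ q =
      (∫⁻ x, ENNReal.ofReal (f x) ^ q ∂(WSob.mE A)).toReal := by
    intro f hf hf0 q hq
    have hfq : Continuous fun x => f x ^ q := hf.rpow_const fun _ => Or.inr hq.le
    rw [integral_eq_lintegral_of_nonneg_ae
      (Filter.Eventually.of_forall fun x => mul_nonneg (hwn x) (Real.rpow_nonneg (hf0 x) _))
      (hwc.mul hfq).aestronglyMeasurable, WSob.mE, ← hR,
      lintegral_withDensity_eq_lintegral_mul _ (WSob.meas_wE A)
        (hf.measurable.ennreal_ofReal.pow_const _)]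
    congr 1
    apply lintegral_congr
    intro x
    rw [Pi.mul_apply, ENNReal.ofReal_mul (hwn x), ENNReal.ofReal_rpow_of_nonneg (hf0 x) hq.le]
  refine ⟨K.toReal, fun u hu hu2 => ?_⟩
  have hg : ∀ x, ‖gradient u x‖ = ‖fderiv ℝ u x‖ := fun x => by
    rw [gradient]; exact LinearIsometryEquiv.norm_map _ _
  have hcf := (hu.continuous_fderiv one_ne_zero)
  simp_rw [hg]
  rw [conv (fun x => |u x|) hu.continuous.abs (fun x => abs_nonneg _) _ hq0,
    conv (fun x => ‖fderiv ℝ u x‖) hcf.norm (fun x => norm_nonneg _) _ hp0]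
  have key := h u hu hu2
  have hY : ∫⁻ x, ‖fderiv ℝ u x‖ₑ ^ p ∂(WSob.mE A) ≠ ⊤ := by
    have hcont : Continuous fun x => ‖fderiv ℝ u x‖ ^ p :=
      hcf.norm.rpow_const fun _ => Or.inr hp0.le
    have hcs : HasCompactSupport fun x => ‖fderiv ℝ u x‖ ^ p :=
      (hu2.fderiv ℝ).comp_left (g := fun t => ‖t‖ ^ p) (by simp [hp0.ne'])
    have := (hcont.integrable_of_hasCompactSupport (μ := WSob.mE A) hcs).hasFiniteIntegral
    rw [hasFiniteIntegral_iff_enorm] at this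
    refine ne_of_lt (lt_of_eq_of_lt ?_ this)
    apply lintegral_congr
    intro x
    rw [Real.enorm_rpow_of_nonneg (norm_nonneg _) hp0.le, enorm_norm]
  have := ENNReal.toReal_mono (ENNReal.mul_ne_top hK
    (ENNReal.rpow_ne_top_of_nonneg (by positivity) hY)) key
  rw [ENNReal.toReal_mul, ← ENNReal.toReal_rpow, ← ENNReal.toReal_rpow] at this
  simp_rw [← ofReal_norm] at this
  exact this
end

section
/- Let A be a strictly positive vector in ℝⁿ, D = A₁+⋯+Aₙ+n. There is a constant C (depending on A, n) such that for every nonnegative C¹ function u with compact support in ℝⁿ satisfying ∂u/∂xᵢ ≤ 0 in the open positive orthant (ℝ₊)ⁿ for every i = 1,...,n, one has (∫_{(ℝ₊)ⁿ} x^A u^{D/(D-1)} dx)^{(D-1)/D} ≤ C ∫_{(ℝ₊)ⁿ} x^A |∇u| dx, and one may take C = (√n / minᵢ Aᵢ) · b^{-1/D} with b = ∫_{[0,1]ⁿ} x^A dx. -/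
open MeasureTheory

lemma oneD (a : ℝ) (ha : 0 < a) (f f' : ℝ → ℝ) (hd : ∀ t, HasDerivAt f (f' t) t)
    (hc : Continuous f') (R : ℝ) (hR : 0 < R) (hfR : ∀ t, R < t → f t = 0)
    (hfR' : ∀ t, R < t → f' t = 0) (hf : ∀ t, 0 ≤ f t) (hf' : ∀ t, 0 < t → f' t ≤ 0) :
    ∫⁻ t in Set.Ioi (0:ℝ), ENNReal.ofReal (a * t ^ (a - 1) * f t) ≤
    ∫⁻ t in Set.Ioi (0:ℝ), ENNReal.ofReal (t ^ a * (- f' t)) := by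
  have hfc : Continuous f := continuous_iff_continuousAt.2 fun t => (hd t).continuousAt
  have i1 : IntegrableOn (fun t : ℝ => a * t ^ (a - 1) * f t) (Set.Ioi 0) := by
    apply IntegrableOn.of_forall_sdiff_eq_zero (s := Set.Ioc 0 R) _ measurableSet_Ioi
    · intro t ht
      have : R < t := by
        by_contra h
        exact ht.2 ⟨ht.1, not_lt.1 h⟩
      simp [hfR t this]
    · have := (intervalIntegral.intervalIntegrable_rpow' (a := 0) (b := R) (r := a - 1)
        (by linarith)).const_mul a
      have := this.mul_continuousOn (g := f) hfc.continuousOn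
      rwa [intervalIntegrable_iff_integrableOn_Ioc_of_le hR.le] at this
  have i2 : IntegrableOn (fun t : ℝ => t ^ a * (f' t)) (Set.Ioi 0) := by
    apply IntegrableOn.of_forall_sdiff_eq_zero (s := Set.Icc 0 R) _ measurableSet_Ioi
    · intro t ht
      have : R < t := by
        by_contra h
        exact ht.2 ⟨le_of_lt ht.1, not_lt.1 h⟩
      simp [hfR' t this]
    · exact ((Real.continuous_rpow_const ha.le).mul hc).continuousOn.integrableOn_Icc
  have i3 : IntegrableOn (fun t : ℝ => t ^ a * (- f' t)) (Set.Ioi 0) := by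
    simpa using i2.neg
  rw [← ofReal_integral_eq_lintegral_ofReal i1, ← ofReal_integral_eq_lintegral_ofReal i3]
  · apply le_of_eq
    congr 1
    have key := integral_Ioi_of_hasDerivAt_of_tendsto (a := 0) (m := 0)
      (f := fun t => t ^ a * f t) (f' := fun t => a * t ^ (a - 1) * f t + t ^ a * f' t)
      (((Real.continuous_rpow_const ha.le).mul hfc).continuousWithinAt)
      (fun t ht => by
        exact (Real.hasDerivAt_rpow_const (Or.inl (ne_of_gt ht))).mul (hd t)) (i1.add i2)
      (tendsto_const_nhds.congr' (by
        filter_upwards [Filter.eventually_gt_atTop R] with t ht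
        simp [hfR t ht]))
    rw [integral_add i1 i2, Real.zero_rpow ha.ne'] at key
    simp only [mul_neg, integral_neg]
    linarith
  · filter_upwards [self_mem_ae_restrict measurableSet_Ioi] with t ht
    exact mul_nonneg (Real.rpow_nonneg (le_of_lt ht) _) (by linarith [hf' t ht])
  · filter_upwards [self_mem_ae_restrict measurableSet_Ioi] with t ht
    exact mul_nonneg (mul_nonneg ha.le (Real.rpow_nonneg (le_of_lt ht) _)) (hf t)

lemma w_cont {n : ℕ} (A : Fin n → ℝ) (hA : ∀ i, 0 < A i) :
    Continuous (fun x : EuclideanSpace ℝ (Fin n) => ∏ i, x i ^ A i) := by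
  refine continuous_finsetProd _ fun i _ => ?_
  exact (Real.continuous_rpow_const (hA i).le).comp (by fun_prop)

lemma cube_compact (n : ℕ) (m : ℝ) :
    IsCompact {x : EuclideanSpace ℝ (Fin n) | ∀ i, 0 ≤ x i ∧ x i ≤ m} := by
  have := (isCompact_univ_pi (fun _ : Fin n => isCompact_Icc (a := (0:ℝ)) (b := m))).image
    (PiLp.continuous_toLp 2 (fun _ : Fin n => ℝ))
  convert this using 1
  ext x
  simp only [Set.mem_image, Set.mem_univ_pi, Set.mem_Icc, Set.mem_ofPred_eq]
  constructor
  · intro h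
    exact ⟨WithLp.ofLp x, h, rfl⟩
  · rintro ⟨y, hy, rfl⟩
    exact hy

lemma b_pos {n : ℕ} (A : Fin n → ℝ) (hA : ∀ i, 0 < A i) :
    0 < ∫ x in {x : EuclideanSpace ℝ (Fin n) | ∀ i, 0 ≤ x i ∧ x i ≤ 1},
        ∏ i, x i ^ A i := by
  have hK := cube_compact n 1
  rw [setIntegral_pos_iff_support_of_nonneg_ae]
  · have ho : IsOpen {x : EuclideanSpace ℝ (Fin n) | ∀ i, 0 < x i ∧ x i < 1} := by
      simp only [Set.ofPred_forall]
      refine isOpen_iInter_of_finite fun i => ?_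
      have hc : Continuous fun x : EuclideanSpace ℝ (Fin n) => x i := by fun_prop
      exact (isOpen_lt continuous_const hc).inter (isOpen_lt hc continuous_const)
    refine (ho.measure_pos volume ⟨WithLp.toLp 2 (fun _ => 1/2), fun i => ?_⟩).trans_le
      (measure_mono ?_)
    · norm_num
    · intro x hx
      refine ⟨?_, fun i => ⟨(hx i).1.le, (hx i).2.le⟩⟩
      exact (Finset.prod_pos fun i _ => Real.rpow_pos_of_pos (hx i).1 _).ne'
  · filter_upwards [self_mem_ae_restrict hK.measurableSet] with x hx
    exact Finset.prod_nonneg fun i _ => Real.rpow_nonneg (hx i).1 _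
  · exact (w_cont A hA).continuousOn.integrableOn_compact hK

open scoped Pointwise in
lemma cube_scale {n : ℕ} (A : Fin n → ℝ) (m : ℝ) (hm : 0 < m) :
    ∫ x in {x : EuclideanSpace ℝ (Fin n) | ∀ i, 0 ≤ x i ∧ x i ≤ m}, ∏ i, x i ^ A i
     = m ^ ((∑ i, A i) + n) *
      ∫ x in {x : EuclideanSpace ℝ (Fin n) | ∀ i, 0 ≤ x i ∧ x i ≤ 1}, ∏ i, x i ^ A i := by
  have h := Measure.setIntegral_comp_smul_of_pos (volume : Measure (EuclideanSpace ℝ (Fin n)))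
    (fun x => ∏ i, x i ^ A i) {x : EuclideanSpace ℝ (Fin n) | ∀ i, 0 ≤ x i ∧ x i ≤ 1} hm
  have hs : m • {x : EuclideanSpace ℝ (Fin n) | ∀ i, 0 ≤ x i ∧ x i ≤ 1}
      = {x : EuclideanSpace ℝ (Fin n) | ∀ i, 0 ≤ x i ∧ x i ≤ m} := by
    ext x
    rw [Set.mem_smul_set_iff_inv_smul_mem₀ hm.ne']
    simp only [Set.mem_ofPred_eq, PiLp.smul_apply, smul_eq_mul]
    refine forall_congr' fun i => ?_
    rw [inv_mul_le_iff₀ hm, mul_one]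
    simp [hm]
  rw [hs] at h
  have h2 : ∫ x in {x : EuclideanSpace ℝ (Fin n) | ∀ i, 0 ≤ x i ∧ x i ≤ 1},
      ∏ i, (m • x) i ^ A i = m ^ (∑ i, A i) *
      ∫ x in {x : EuclideanSpace ℝ (Fin n) | ∀ i, 0 ≤ x i ∧ x i ≤ 1}, ∏ i, x i ^ A i := by
    rw [← integral_const_mul]
    refine setIntegral_congr_fun (cube_compact n 1).measurableSet fun x hx => ?_
    simp only [PiLp.smul_apply, smul_eq_mul]
    rw [Real.rpow_sum_of_pos hm, ← Finset.prod_mul_distrib]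
    exact Finset.prod_congr rfl fun i _ => Real.mul_rpow hm.le (hx i).1
  rw [h2] at h
  simp only [finrank_euclideanSpace, Fintype.card_fin, smul_eq_mul] at h
  rw [Real.rpow_add hm, Real.rpow_natCast, mul_right_comm, h, mul_right_comm,
    inv_mul_cancel₀ (pow_pos hm n).ne', one_mul]

lemma u_mono {n : ℕ} (u : EuclideanSpace ℝ (Fin n) → ℝ) (hu : ContDiff ℝ 1 u)
    (hmono : ∀ x : EuclideanSpace ℝ (Fin n), (∀ i, 0 < x i) → ∀ i, gradient u x i ≤ 0)
    (x y : EuclideanSpace ℝ (Fin n)) (hy : ∀ i, 0 < y i) (hxy : ∀ i, y i ≤ x i) :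
    u x ≤ u y := by
  have hder : ∀ t : ℝ, HasDerivAt (fun t : ℝ => u (y + t • (x - y)))
      (fderiv ℝ u (y + t • (x - y)) (x - y)) t := by
    intro t
    have h1 : HasDerivAt (fun t : ℝ => y + t • (x - y)) (x - y) t := by
      simpa using ((hasDerivAt_id t).smul_const (x - y)).const_add y
    exact ((hu.differentiable (by simp)) _).hasFDerivAt.comp_hasDerivAt t h1
  have := antitoneOn_of_deriv_nonpos (convex_Icc (0:ℝ) 1)
    (f := fun t : ℝ => u (y + t • (x - y)))
    (fun t _ => (hder t).continuousAt.continuousWithinAt)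
    (fun t _ => (hder t).differentiableAt.differentiableWithinAt)
    (fun t ht => by
      rw [interior_Icc] at ht
      rw [(hder t).deriv, ← inner_gradient_left, PiLp.inner_apply]
      refine Finset.sum_nonpos fun i _ => ?_
      have hp : ∀ i, 0 < (y + t • (x - y)) i := by
        intro i
        have := mul_nonneg ht.1.le (sub_nonneg.2 (hxy i))
        simp only [PiLp.add_apply, PiLp.smul_apply, PiLp.sub_apply, smul_eq_mul]
        linarith [hy i]
      have h1 := hmono _ hp i
      have h2 := sub_nonneg.2 (hxy i)
      simp only [PiLp.sub_apply, RCLike.inner_apply, conj_trivial]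
      exact mul_nonpos_of_nonneg_of_nonpos h2 h1)
  have := this (Set.left_mem_Icc.2 zero_le_one) (Set.right_mem_Icc.2 zero_le_one) zero_le_one
  simpa using this

lemma orth_meas (n : ℕ) : MeasurableSet {x : EuclideanSpace ℝ (Fin n) | ∀ i, 0 < x i} := by
  refine IsOpen.measurableSet ?_
  simp only [Set.ofPred_forall]
  refine isOpen_iInter_of_finite fun i => ?_
  have hc : Continuous fun x : EuclideanSpace ℝ (Fin n) => x i := by fun_prop
  exact isOpen_lt continuous_const hc

lemma cube_bound {n : ℕ} (A : Fin n → ℝ) (hA : ∀ i, 0 < A i) (p : ℝ) (hp : 0 < p)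
    (u : EuclideanSpace ℝ (Fin n) → ℝ) (hu : ContDiff ℝ 1 u)
    (hupos : ∀ x, 0 ≤ u x)
    (hmono : ∀ x : EuclideanSpace ℝ (Fin n), (∀ i, 0 < x i) → ∀ i, gradient u x i ≤ 0)
    (hint : Integrable (fun x : EuclideanSpace ℝ (Fin n) => (∏ i, x i ^ A i) * u x ^ p))
    (x : EuclideanSpace ℝ (Fin n)) (m : ℝ) (hm : 0 < m) (hx : ∀ i, m ≤ x i) :
    u x ^ p * (m ^ ((∑ i, A i) + n) *
      ∫ x in {x : EuclideanSpace ℝ (Fin n) | ∀ i, 0 ≤ x i ∧ x i ≤ 1}, ∏ i, x i ^ A i) ≤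
    ∫ x in {x : EuclideanSpace ℝ (Fin n) | ∀ i, 0 < x i}, (∏ i, x i ^ A i) * u x ^ p := by
  rw [← cube_scale A m hm]
  set P := {x : EuclideanSpace ℝ (Fin n) | ∀ i, 0 < x i}
  set Q := {x : EuclideanSpace ℝ (Fin n) | ∀ i, 0 ≤ x i ∧ x i ≤ m}
  have hQ : IsCompact Q := cube_compact n m
  have hP : MeasurableSet P := orth_meas n
  have hwQ := (w_cont A hA).continuousOn.integrableOn_compact (μ := volume) hQ
  have e1 : ∫ x in Q, ∏ i, x i ^ A i = ∫ x in P ∩ Q, ∏ i, x i ^ A i := by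
    refine setIntegral_eq_of_subset_of_forall_sdiff_eq_zero hQ.measurableSet
      Set.inter_subset_right ?_
    intro y hy
    have : ∃ i, y i ≤ 0 := by
      by_contra! h
      exact hy.2 ⟨h, hy.1⟩
    obtain ⟨i, hi⟩ := this
    refine Finset.prod_eq_zero (Finset.mem_univ i) ?_
    rw [le_antisymm hi (hy.1 i).1, Real.zero_rpow (hA i).ne']
  rw [e1, ← integral_const_mul]
  calc _ ≤ ∫ x in P ∩ Q, (∏ i, x i ^ A i) * u x ^ p := by
        refine setIntegral_mono_on ((hwQ.mono_set Set.inter_subset_right).const_mul _)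
          hint.integrableOn (hP.inter hQ.measurableSet) fun y hy => ?_
        rw [mul_comm]
        refine mul_le_mul_of_nonneg_left ?_
          (Finset.prod_nonneg fun i _ => Real.rpow_nonneg (hy.2 i).1 _)
        exact Real.rpow_le_rpow (hupos x) (u_mono u hu hmono x y hy.1
          fun i => (hy.2 i).2.trans (hx i)) hp.le
    _ ≤ _ := by
        refine setIntegral_mono_set hint.integrableOn ?_ Set.inter_subset_left.eventuallyLE
        filter_upwards [self_mem_ae_restrict hP] with y hy
        exact mul_nonneg (Finset.prod_nonneg fun i _ => Real.rpow_nonneg (hy i).le _)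
          (Real.rpow_nonneg (hupos y) _)

lemma grad_cont {n : ℕ} (u : EuclideanSpace ℝ (Fin n) → ℝ) (hu : ContDiff ℝ 1 u) :
    Continuous (gradient u) := by
  unfold gradient
  exact (LinearIsometryEquiv.continuous _).comp (hu.continuous_fderiv (by simp))

lemma ibp {n : ℕ} (A : Fin n → ℝ) (hA : ∀ i, 0 < A i)
    (u : EuclideanSpace ℝ (Fin n) → ℝ) (hu : ContDiff ℝ 1 u)
    (hsupp : HasCompactSupport u) (hupos : ∀ x, 0 ≤ u x)
    (hmono : ∀ x : EuclideanSpace ℝ (Fin n), (∀ i, 0 < x i) → ∀ i, gradient u x i ≤ 0)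
    (i : Fin n) :
    ∫⁻ x in {x : EuclideanSpace ℝ (Fin n) | ∀ i, 0 < x i},
      ENNReal.ofReal (A i * ((∏ i, x i ^ A i) / x i) * u x) ≤
    ∫⁻ x in {x : EuclideanSpace ℝ (Fin n) | ∀ i, 0 < x i},
      ENNReal.ofReal ((∏ i, x i ^ A i) * (- gradient u x i)) := by
  have hP : MeasurableSet {x : EuclideanSpace ℝ (Fin n) | ∀ i, 0 < x i} := orth_meas n
  have hci : ∀ i, Continuous fun x : EuclideanSpace ℝ (Fin n) => x i := fun i => by fun_prop
  have hgi : Continuous fun x => gradient u x i := (hci i).comp (grad_cont u hu)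
  rw [← lintegral_indicator hP, ← lintegral_indicator hP]
  have m1 : Measurable (Set.indicator {x : EuclideanSpace ℝ (Fin n) | ∀ i, 0 < x i}
      fun x => ENNReal.ofReal (A i * ((∏ i, x i ^ A i) / x i) * u x)) :=
    ((((w_cont A hA).measurable.div (hci i).measurable).const_mul _).mul
      hu.continuous.measurable).ennreal_ofReal.indicator hP
  have m2 : Measurable (Set.indicator {x : EuclideanSpace ℝ (Fin n) | ∀ i, 0 < x i}
      fun x => ENNReal.ofReal ((∏ i, x i ^ A i) * (- gradient u x i))) :=
    ((w_cont A hA).mul hgi.neg).measurable.ennreal_ofReal.indicator hP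
  rw [← (PiLp.volume_preserving_toLp (Fin n)).lintegral_comp m1,
    ← (PiLp.volume_preserving_toLp (Fin n)).lintegral_comp m2, volume_pi]
  have mt := (PiLp.volume_preserving_toLp (Fin n)).measurable
  refine lintegral_le_of_lmarginal_le {i} (m1.comp mt) (m2.comp mt) ?_
  rw [lmarginal_singleton, lmarginal_singleton]
  intro z
  simp only
  obtain ⟨R, hR, hRs⟩ := hsupp.isCompact.isBounded.exists_pos_norm_le
  by_cases hz : ∀ j, j ≠ i → 0 < z j
  swap
  · push Not at hz
    obtain ⟨j, hj, hj0⟩ := hz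
    refine le_of_eq_of_le ?_ zero_le
    rw [← lintegral_zero]
    refine lintegral_congr fun t => Set.indicator_of_notMem ?_ _
    intro h
    have := h j
    simp [hj] at this
    linarith
  set c : ℝ := ∏ j ∈ Finset.univ.erase i, z j ^ A j
  have hc : 0 ≤ c := Finset.prod_nonneg fun j hj =>
    Real.rpow_nonneg (hz j (Finset.ne_of_mem_erase hj)).le _
  set L : ℝ → EuclideanSpace ℝ (Fin n) := fun t => WithLp.toLp 2 (Function.update z i t)
  have hLi : ∀ t, L t i = t := fun t => by simp [L]
  have hLp : ∀ t, L t ∈ {x : EuclideanSpace ℝ (Fin n) | ∀ i, 0 < x i} ↔ t ∈ Set.Ioi (0:ℝ) := by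
    intro t
    constructor
    · intro h
      have := h i
      rwa [hLi] at this
    · intro h j
      by_cases hj : j = i
      · subst hj; rw [hLi]; exact h
      · simpa [L, hj] using hz j hj
  have hw : ∀ t, ∏ j, L t j ^ A j = t ^ A i * c := by
    intro t
    rw [← Finset.mul_prod_erase _ _ (Finset.mem_univ i), hLi]
    congr 1
    refine Finset.prod_congr rfl fun j hj => ?_
    simp [L, Finset.ne_of_mem_erase hj]
  have hLd : ∀ t, HasDerivAt L (EuclideanSpace.single i 1) t := by
    intro t
    have : L = fun t => L 0 + t • EuclideanSpace.single i (1:ℝ) := by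
      funext t
      ext j
      by_cases hj : j = i
      · subst hj; simp [L]
      · simp [L, hj]
    rw [this]
    simpa using ((hasDerivAt_id t).smul_const (EuclideanSpace.single i (1:ℝ))).const_add (L 0)
  have hLc : Continuous L := continuous_iff_continuousAt.2 fun t => (hLd t).continuousAt
  have hnot : ∀ t, R < t → L t ∉ tsupport u := by
    intro t ht h
    have h1 := hRs _ h
    have h2 := PiLp.norm_apply_le (L t) i
    rw [hLi, Real.norm_eq_abs] at h2
    linarith [le_abs_self t]
  have one := oneD (A i) (hA i) (fun t => u (L t)) (fun t => gradient u (L t) i)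
    (fun t => by
      have := ((hu.differentiable (by simp)) (L t)).hasFDerivAt.comp_hasDerivAt t (hLd t)
      rw [← inner_gradient_left, EuclideanSpace.inner_single_right] at this
      simp only [one_mul, conj_trivial] at this
      exact this)
    (hgi.comp hLc) R hR (fun t ht => image_eq_zero_of_notMem_tsupport (hnot t ht))
    (fun t ht => by
      have : fderiv ℝ u (L t) = 0 := by
        by_contra h
        exact hnot t ht (support_fderiv_subset ℝ h)
      simp [gradient, this])
    (fun t => hupos _) (fun t ht => hmono _ ((hLp t).2 ht) i)
  have conv : ∀ F : EuclideanSpace ℝ (Fin n) → ℝ, ∀ G : ℝ → ℝ,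
      (∀ t, 0 < t → F (L t) = c * G t) →
      ∫⁻ t, (Set.indicator {x : EuclideanSpace ℝ (Fin n) | ∀ i, 0 < x i}
        fun x => ENNReal.ofReal (F x)) (L t)
      = ENNReal.ofReal c * ∫⁻ t in Set.Ioi (0:ℝ), ENNReal.ofReal (G t) := by
    intro F G h
    rw [← lintegral_const_mul' _ _ ENNReal.ofReal_ne_top, ← lintegral_indicator measurableSet_Ioi]
    refine lintegral_congr fun t => ?_
    by_cases ht : t ∈ Set.Ioi (0:ℝ)
    · rw [Set.indicator_of_mem ((hLp t).2 ht), Set.indicator_of_mem ht, h t ht,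
        ENNReal.ofReal_mul hc]
    · rw [Set.indicator_of_notMem (fun h => ht ((hLp t).1 h)), Set.indicator_of_notMem ht]
  have c1 := conv (fun x => A i * ((∏ i, x i ^ A i) / x i) * u x)
    (fun t => A i * t ^ (A i - 1) * u (L t)) (fun t ht => by
      simp only
      rw [hw, hLi, Real.rpow_sub_one ht.ne']
      ring)
  have c2 := conv (fun x => (∏ i, x i ^ A i) * (- gradient u x i))
    (fun t => t ^ A i * (- gradient u (L t) i)) (fun t ht => by
      simp only
      rw [hw]
      ring)
  calc _ = _ := c1
    _ ≤ _ := mul_le_mul_right one _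
    _ = _ := c2.symm


/-- Weighted Sobolev inequality (`p = 1`, nonoptimal explicit constant) in the positive
orthant for monotone functions. -/
theorem weighted_sobolev_monotone (n : ℕ) [NeZero n] (A : Fin n → ℝ) (hA : ∀ i, 0 < A i)
    (D : ℝ) (hD : D = (∑ i, A i) + n)
    (b : ℝ)
    (hb : b = ∫ x in {x : EuclideanSpace ℝ (Fin n) | ∀ i, 0 ≤ x i ∧ x i ≤ 1},
        ∏ i, x i ^ A i)
    (C : ℝ)
    (hC : C = (Real.sqrt n / (Finset.univ.inf' Finset.univ_nonempty A)) * b ^ (-(1 / D)))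
    (u : EuclideanSpace ℝ (Fin n) → ℝ) (hu : ContDiff ℝ 1 u)
    (hsupp : HasCompactSupport u) (hupos : ∀ x, 0 ≤ u x)
    (hmono : ∀ x : EuclideanSpace ℝ (Fin n), (∀ i, 0 < x i) →
      ∀ i, gradient u x i ≤ 0) :
    (∫ x in {x : EuclideanSpace ℝ (Fin n) | ∀ i, 0 < x i},
        (∏ i, x i ^ A i) * u x ^ (D / (D - 1))) ^ ((D - 1) / D)
      ≤ C * ∫ x in {x : EuclideanSpace ℝ (Fin n) | ∀ i, 0 < x i},
          (∏ i, x i ^ A i) * ‖gradient u x‖ := by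
  have hci : ∀ i, Continuous fun x : EuclideanSpace ℝ (Fin n) => x i := fun i => by fun_prop
  have hP : MeasurableSet {x : EuclideanSpace ℝ (Fin n) | ∀ i, 0 < x i} := orth_meas n
  have hnpos : (1:ℝ) ≤ n := by exact_mod_cast Nat.one_le_iff_ne_zero.2 (NeZero.ne n)
  have hApos : 0 < ∑ i, A i := Finset.sum_pos (fun i _ => hA i) Finset.univ_nonempty
  have hD1 : 0 < D - 1 := by rw [hD]; linarith
  have hD0 : 0 < D := by linarith
  have hb0 : 0 < b := by rw [hb]; exact b_pos A hA
  have hp : 0 < D / (D - 1) := div_pos hD0 hD1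
  set p := D / (D - 1) with hpdef
  set a := Finset.univ.inf' Finset.univ_nonempty A with ha
  have ha0 : 0 < a := (Finset.lt_inf'_iff _).2 fun i _ => hA i
  have haA : ∀ i, a ≤ A i := fun i => Finset.inf'_le _ (Finset.mem_univ i)
  have hw := w_cont A hA
  have hg := grad_cont u hu
  have hgs : HasCompactSupport (gradient u) :=
    (hsupp.fderiv (𝕜 := ℝ)).comp_left (g := (InnerProductSpace.toDual ℝ _).symm) (map_zero _)
  have i1 : Integrable fun x : EuclideanSpace ℝ (Fin n) => (∏ i, x i ^ A i) * u x ^ p := by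
    refine (hw.mul (hu.continuous.rpow_const fun _ => Or.inr hp.le)).integrable_of_hasCompactSupport
      ?_
    exact (hsupp.comp_left (g := fun t : ℝ => t ^ p) (Real.zero_rpow hp.ne')).mul_left
  have i2 : Integrable fun x : EuclideanSpace ℝ (Fin n) => (∏ i, x i ^ A i) * ‖gradient u x‖ := by
    refine (hw.mul hg.norm).integrable_of_hasCompactSupport ?_
    exact hgs.norm.mul_left
  have i3 : ∀ j, Integrable fun x : EuclideanSpace ℝ (Fin n) =>
      (∏ i, x i ^ A i) * (-gradient u x j) := by
    intro j
    refine (hw.mul ((hci j).comp hg).neg).integrable_of_hasCompactSupport ?_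
    exact (hgs.comp_left (g := fun v : EuclideanSpace ℝ (Fin n) => - v j) (by simp)).mul_left
  have hcube := cube_bound A hA p hp u hu hupos hmono i1
  rw [← hb, ← hD] at hcube
  have hw0 : ∀ x ∈ {x : EuclideanSpace ℝ (Fin n) | ∀ i, 0 < x i}, 0 ≤ ∏ i, x i ^ A i :=
    fun x hx => Finset.prod_nonneg fun i _ => Real.rpow_nonneg (hx i).le _
  have hI0 : 0 ≤ ∫ x in {x : EuclideanSpace ℝ (Fin n) | ∀ i, 0 < x i},
        (∏ i, x i ^ A i) * u x ^ p :=
    setIntegral_nonneg hP fun x hx => mul_nonneg (hw0 x hx) (Real.rpow_nonneg (hupos x) _)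
  have hK0 : 0 ≤ ∫ x in {x : EuclideanSpace ℝ (Fin n) | ∀ i, 0 < x i},
        (∏ i, x i ^ A i) * ‖gradient u x‖ :=
    setIntegral_nonneg hP fun x hx => mul_nonneg (hw0 x hx) (norm_nonneg _)
  set I := ∫ x in {x : EuclideanSpace ℝ (Fin n) | ∀ i, 0 < x i},
        (∏ i, x i ^ A i) * u x ^ p with hI
  set K := ∫ x in {x : EuclideanSpace ℝ (Fin n) | ∀ i, 0 < x i},
        (∏ i, x i ^ A i) * ‖gradient u x‖ with hK
  rcases hI0.eq_or_lt with h0 | hIpos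
  · rw [← h0, Real.zero_rpow (div_pos hD1 hD0).ne', hC]
    positivity
  set c := a * (b ^ (1 / D) * I ^ (-(1 / D))) with hc
  have hc0 : 0 ≤ c := by positivity
  have pt : ∀ x ∈ {x : EuclideanSpace ℝ (Fin n) | ∀ i, 0 < x i},
      c * ((∏ i, x i ^ A i) * u x ^ p) ≤ ∑ j, A j * ((∏ i, x i ^ A i) / x j) * u x := by
    intro x hx
    obtain ⟨j, -, hj⟩ := Finset.exists_mem_eq_inf' (Finset.univ_nonempty (α := Fin n)) (fun i => x i)
    have h1 := hcube x (x j) (hx j) (fun i => hj ▸ Finset.inf'_le _ (Finset.mem_univ i))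
    have hxj := hx j
    have hup := Real.rpow_nonneg (hupos x) p
    have h2 : b * u x ^ p * I⁻¹ ≤ (x j)⁻¹ ^ D := by
      rw [Real.inv_rpow hxj.le, ← div_eq_mul_inv, div_le_iff₀ hIpos,
        le_inv_mul_iff₀ (Real.rpow_pos_of_pos hxj _)]
      linarith
    have h3 : (b * u x ^ p * I⁻¹) ^ (1 / D) ≤ (x j)⁻¹ := by
      have := Real.rpow_le_rpow (by positivity) h2 (one_div_pos.2 hD0).le
      rwa [← Real.rpow_mul (inv_pos.2 hxj).le, mul_one_div_cancel hD0.ne', Real.rpow_one] at this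
    rw [Real.mul_rpow (by positivity) (by positivity), Real.mul_rpow hb0.le hup,
      Real.inv_rpow hIpos.le, ← Real.rpow_neg hIpos.le, ← Real.rpow_mul (hupos x)] at h3
    have h4 : u x ^ p = u x * u x ^ (p * (1 / D)) := by
      have e : p = 1 + p * (1 / D) := by
        rw [hpdef]; field_simp; ring
      have hpd : 0 ≤ p * (1 / D) := by positivity
      conv_lhs => rw [e]
      rw [Real.rpow_add_of_nonneg (hupos x) zero_le_one hpd, Real.rpow_one]
    have hwx := hw0 x hx
    calc c * ((∏ i, x i ^ A i) * u x ^ p)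
        = (a * (∏ i, x i ^ A i) * u x) * (b ^ (1 / D) * u x ^ (p * (1 / D)) * I ^ (-(1 / D))) := by
          rw [h4, hc]; ring
      _ ≤ (a * (∏ i, x i ^ A i) * u x) * (x j)⁻¹ :=
          mul_le_mul_of_nonneg_left h3 (mul_nonneg (mul_nonneg ha0.le hwx) (hupos x))
      _ = a * (((∏ i, x i ^ A i) / x j) * u x) := by rw [div_eq_mul_inv]; ring
      _ ≤ A j * (((∏ i, x i ^ A i) / x j) * u x) :=
          mul_le_mul_of_nonneg_right (haA j) (mul_nonneg (div_nonneg hwx hxj.le) (hupos x))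
      _ = A j * ((∏ i, x i ^ A i) / x j) * u x := by ring
      _ ≤ _ := Finset.single_le_sum (f := fun j => A j * ((∏ i, x i ^ A i) / x j) * u x)
          (fun k _ => mul_nonneg (mul_nonneg (hA k).le (div_nonneg hwx (hx k).le)) (hupos x))
          (Finset.mem_univ j)
  have pt2 : ∀ x ∈ {x : EuclideanSpace ℝ (Fin n) | ∀ i, 0 < x i},
      ∑ j, (∏ i, x i ^ A i) * (-gradient u x j) ≤
      Real.sqrt n * ((∏ i, x i ^ A i) * ‖gradient u x‖) := by
    intro x hx
    rw [← Finset.mul_sum, mul_left_comm]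
    refine mul_le_mul_of_nonneg_left ?_ (hw0 x hx)
    rw [EuclideanSpace.norm_eq, ← Real.sqrt_mul (by positivity)]
    apply Real.le_sqrt_of_sq_le
    have := sq_sum_le_card_mul_sum_sq (s := Finset.univ) (f := fun j => -gradient u x j)
    simpa using this
  have key : c * I ≤ Real.sqrt n * K := by
    rw [← ENNReal.ofReal_le_ofReal_iff (by positivity), hI, ← integral_const_mul,
      ofReal_integral_eq_lintegral_ofReal (i1.integrableOn.const_mul c)
      (by
        filter_upwards [self_mem_ae_restrict hP] with x hx
        exact mul_nonneg hc0 (mul_nonneg (hw0 x hx) (Real.rpow_nonneg (hupos x) _)))]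
    calc _ ≤ ∫⁻ x in {x : EuclideanSpace ℝ (Fin n) | ∀ i, 0 < x i},
          ∑ j, ENNReal.ofReal (A j * ((∏ i, x i ^ A i) / x j) * u x) := by
          refine setLIntegral_mono' hP fun x hx => ?_
          rw [← ENNReal.ofReal_sum_of_nonneg]
          · exact ENNReal.ofReal_le_ofReal (pt x hx)
          · exact fun k _ => mul_nonneg (mul_nonneg (hA k).le
              (div_nonneg (hw0 x hx) (hx k).le)) (hupos x)
      _ = ∑ j, ∫⁻ x in {x : EuclideanSpace ℝ (Fin n) | ∀ i, 0 < x i},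
          ENNReal.ofReal (A j * ((∏ i, x i ^ A i) / x j) * u x) := by
          refine lintegral_finsetSum _ fun j _ => ?_
          exact (((hw.measurable.div (hci j).measurable).const_mul _).mul
            hu.continuous.measurable).ennreal_ofReal
      _ ≤ ∑ j, ∫⁻ x in {x : EuclideanSpace ℝ (Fin n) | ∀ i, 0 < x i},
          ENNReal.ofReal ((∏ i, x i ^ A i) * (-gradient u x j)) :=
          Finset.sum_le_sum fun j _ => ibp A hA u hu hsupp hupos hmono j
      _ = ∑ j, ENNReal.ofReal (∫ x in {x : EuclideanSpace ℝ (Fin n) | ∀ i, 0 < x i},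
          (∏ i, x i ^ A i) * (-gradient u x j)) := by
          refine Finset.sum_congr rfl fun j _ => ?_
          rw [ofReal_integral_eq_lintegral_ofReal (i3 j).integrableOn]
          filter_upwards [self_mem_ae_restrict hP] with x hx
          exact mul_nonneg (hw0 x hx) (neg_nonneg.2 (hmono x hx j))
      _ = ENNReal.ofReal (∑ j, ∫ x in {x : EuclideanSpace ℝ (Fin n) | ∀ i, 0 < x i},
          (∏ i, x i ^ A i) * (-gradient u x j)) := by
          rw [ENNReal.ofReal_sum_of_nonneg]
          exact fun j _ => setIntegral_nonneg hP fun x hx =>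
            mul_nonneg (hw0 x hx) (neg_nonneg.2 (hmono x hx j))
      _ ≤ _ := by
          refine ENNReal.ofReal_le_ofReal ?_
          rw [← integral_finsetSum _ (fun j _ => (i3 j).integrableOn), hK, ← integral_const_mul]
          exact setIntegral_mono_on (integrable_finsetSum _ fun j _ => (i3 j).integrableOn)
            (i2.integrableOn.const_mul _) hP pt2
  have e1 : I ^ ((D - 1) / D) = I ^ (-(1 / D)) * I := by
    rw [← Real.rpow_add_one hIpos.ne']
    congr 1
    field_simp
    ring
  have hbp : 0 < b ^ (1 / D) := Real.rpow_pos_of_pos hb0 _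
  rw [e1, hC, Real.rpow_neg hb0.le]
  have : Real.sqrt n / a * (b ^ (1 / D))⁻¹ * K = (Real.sqrt n * K) / (a * b ^ (1 / D)) := by
    rw [div_mul_eq_mul_div, div_mul_eq_mul_div, mul_right_comm, ← div_eq_mul_inv, div_div, mul_comm a]
  rw [this, le_div_iff₀ (by positivity)]
  calc _ = c * I := by rw [hc]; ring
    _ ≤ _ := key
end

section
/- Let A be a strictly positive vector in ℝⁿ and K = √n / minᵢ Aᵢ. For every nonnegative C¹ function u with compact support in ℝⁿ satisfying ∂u/∂xᵢ ≤ 0 in (ℝ₊)ⁿ for all i, one has ∫_{(ℝ₊)ⁿ} x^A u(x) (1/x₁ + ⋯ + 1/xₙ) dx ≤ K ∫_{(ℝ₊)ⁿ} x^A |∇u| dx. -/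
open MeasureTheory

theorem wh_line_deriv {m : ℕ} (i : Fin (m + 1)) (y : Fin m → ℝ)
    (u : EuclideanSpace ℝ (Fin (m + 1)) → ℝ) (hu : ContDiff ℝ 1 u) (t : ℝ) :
    HasDerivAt (fun t : ℝ => u (WithLp.toLp 2 (i.insertNth t y)))
      (gradient u (WithLp.toLp 2 (i.insertNth t y)) i) t := by
  have h1 : HasDerivAt (fun t : ℝ => (i.insertNth t y : Fin (m + 1) → ℝ)) (Pi.single i 1) t := by
    have := hasDerivAt_update (i.insertNth 0 y : Fin (m + 1) → ℝ) i t
    have e : Function.update (i.insertNth 0 y : Fin (m + 1) → ℝ) i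
      = fun t : ℝ => (i.insertNth t y : Fin (m + 1) → ℝ) := by
      funext s
      exact Fin.update_insertNth (α := fun _ => ℝ) i 0 s y
    rwa [e] at this
  have h2 := ((PiLp.continuousLinearEquiv 2 ℝ
    (fun _ : Fin (m + 1) => ℝ)).symm.toContinuousLinearMap.hasFDerivAt).comp_hasDerivAt t h1
  have h3 := ((hu.differentiable (by norm_num)
    (WithLp.toLp 2 (i.insertNth t y))).hasGradientAt.hasFDerivAt).comp_hasDerivAt t h2
  refine HasDerivAt.congr_deriv h3 ?_
  have := EuclideanSpace.inner_single_right (𝕜 := ℝ) i 1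
    (gradient u (WithLp.toLp 2 (i.insertNth t y)))
  simp at this
  simpa using this

theorem wh_inner {m : ℕ} (i : Fin (m + 1)) (y : Fin m → ℝ) (a : ℝ) (ha : 0 < a)
    (u : EuclideanSpace ℝ (Fin (m + 1)) → ℝ) (hu : ContDiff ℝ 1 u)
    (hsupp : HasCompactSupport u) :
    ∫ t in Set.Ioi (0 : ℝ), (t ^ a * gradient u (WithLp.toLp 2 (i.insertNth t y)) i
      + a * (t ^ a * u (WithLp.toLp 2 (i.insertNth t y)) * (1 / t))) = 0 := by
  by_cases hI : IntegrableOn (fun t : ℝ => t ^ a * gradient u (WithLp.toLp 2 (i.insertNth t y)) i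
      + a * (t ^ a * u (WithLp.toLp 2 (i.insertNth t y)) * (1 / t))) (Set.Ioi 0)
  swap
  · exact integral_undef hI
  have hd := wh_line_deriv i y u hu
  rw [integral_Ioi_of_hasDerivAt_of_tendsto (m := 0)
    (f := fun t : ℝ => t ^ a * u (WithLp.toLp 2 (i.insertNth t y))) _ _ hI]
  · simp [Real.zero_rpow ha.ne']
  · obtain ⟨R, hR⟩ := hsupp.isCompact.isBounded.exists_norm_le
    refine tendsto_const_nhds.congr' ?_
    filter_upwards [Filter.eventually_gt_atTop R, Filter.eventually_gt_atTop 0] with t ht ht0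
    have : u (WithLp.toLp 2 (i.insertNth t y)) = 0 := by
      by_contra hne
      have h1 := hR _ (subset_tsupport u hne)
      have h2 := PiLp.norm_apply_le
        (WithLp.toLp 2 (i.insertNth t y) : EuclideanSpace ℝ (Fin (m + 1))) i
      simp [abs_of_pos ht0] at h2
      linarith
    simp [this]
  · apply ContinuousAt.continuousWithinAt
    exact (Real.continuousAt_rpow_const _ _ (Or.inr ha.le)).mul (hd 0).continuousAt
  · intro t ht
    have ht : 0 < t := ht
    refine HasDerivAt.congr_deriv
      ((Real.hasDerivAt_rpow_const (p := a) (Or.inl ht.ne')).mul (hd t)) ?_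
    rw [Real.rpow_sub_one ht.ne']
    ring

theorem wh_coord {m : ℕ} (i : Fin (m + 1)) (A : Fin (m + 1) → ℝ) (hA : ∀ i, 0 < A i)
    (u : EuclideanSpace ℝ (Fin (m + 1)) → ℝ) (hu : ContDiff ℝ 1 u)
    (hsupp : HasCompactSupport u) :
    ∫ x in {x : EuclideanSpace ℝ (Fin (m + 1)) | ∀ i, 0 < x i},
      ((∏ j, x j ^ A j) * gradient u x i + A i * ((∏ j, x j ^ A j) * u x * (1 / x i))) = 0 := by
  have hS : MeasurableSet {x : EuclideanSpace ℝ (Fin (m + 1)) | ∀ i, 0 < x i} := by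
    simp only [Set.setOf_forall]
    exact MeasurableSet.iInter fun i => measurableSet_lt (by fun_prop) (by fun_prop)
  rw [← integral_indicator hS]
  set G := Set.indicator {x : EuclideanSpace ℝ (Fin (m + 1)) | ∀ i, 0 < x i} (fun x =>
    (∏ j, x j ^ A j) * gradient u x i + A i * ((∏ j, x j ^ A j) * u x * (1 / x i))) with hG
  rw [← ((EuclideanSpace.volume_preserving_symm_measurableEquiv_toLp
    (Fin (m + 1))).symm _).integral_comp' G]
  rw [← ((volume_preserving_piFinSuccAbove (fun _ : Fin (m + 1) => ℝ) i).symm _).integral_comp']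
  by_cases hI : Integrable (fun z : ℝ × (Fin m → ℝ) => G ((MeasurableEquiv.toLp 2 (Fin (m+1) → ℝ))
      ((MeasurableEquiv.piFinSuccAbove (fun _ : Fin (m + 1) => ℝ) i).symm z)))
  swap
  · exact integral_undef hI
  refine (integral_prod_symm _ hI).trans ?_
  refine integral_eq_zero_of_ae (Filter.Eventually.of_forall fun y => ?_)
  have key : ∀ t : ℝ, G ((MeasurableEquiv.toLp 2 (Fin (m+1) → ℝ))
      ((MeasurableEquiv.piFinSuccAbove (fun _ : Fin (m + 1) => ℝ) i).symm (t, y)))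
      = G (WithLp.toLp 2 (i.insertNth t y)) := fun t => rfl
  simp only [key, Pi.zero_apply]
  by_cases hy : ∀ j, 0 < y j
  · have : ∀ t, G (WithLp.toLp 2 (i.insertNth t y)) = (∏ j, y j ^ A (i.succAbove j)) *
        Set.indicator (Set.Ioi 0) (fun t : ℝ =>
        (t ^ A i * gradient u (WithLp.toLp 2 (i.insertNth t y)) i
        + A i * (t ^ A i * u (WithLp.toLp 2 (i.insertNth t y)) * (1 / t)))) t := by
      intro t
      by_cases ht : 0 < t
      · rw [hG, Set.indicator_of_mem, Set.indicator_of_mem (Set.mem_Ioi.2 ht)]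
        · rw [Fin.prod_univ_succAbove _ i]
          simp
          ring
        · simp only [Set.mem_setOf_eq]
          rw [Fin.forall_iff_succAbove i]
          simpa using ⟨ht, hy⟩
      · rw [hG, Set.indicator_of_notMem, Set.indicator_of_notMem (by simpa using ht), mul_zero]
        intro h
        have := h i
        simp at this
        exact ht this
    simp only [this]
    rw [integral_const_mul, integral_indicator measurableSet_Ioi,
      wh_inner i y (A i) (hA i) u hu hsupp, mul_zero]
  · have : ∀ t, G (WithLp.toLp 2 (i.insertNth t y)) = 0 := by
      intro t
      rw [hG, Set.indicator_of_notMem]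
      intro h
      apply hy
      intro j
      simpa using h (i.succAbove j)
    simp [this]

/-- Hardy-type estimate in the positive orthant for monotone functions. -/
theorem weighted_hardy_monotone (n : ℕ) [NeZero n] (A : Fin n → ℝ) (hA : ∀ i, 0 < A i)
    (K : ℝ) (hK : K = Real.sqrt n / (Finset.univ.inf' Finset.univ_nonempty A))
    (u : EuclideanSpace ℝ (Fin n) → ℝ) (hu : ContDiff ℝ 1 u)
    (hsupp : HasCompactSupport u) (hupos : ∀ x, 0 ≤ u x)
    (hmono : ∀ x : EuclideanSpace ℝ (Fin n), (∀ i, 0 < x i) →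
      ∀ i, gradient u x i ≤ 0) :
    (∫ x in {x : EuclideanSpace ℝ (Fin n) | ∀ i, 0 < x i},
        (∏ i, x i ^ A i) * u x * (∑ i, 1 / x i))
      ≤ K * ∫ x in {x : EuclideanSpace ℝ (Fin n) | ∀ i, 0 < x i},
          (∏ i, x i ^ A i) * ‖gradient u x‖ := by
  obtain ⟨m, rfl⟩ : ∃ m, n = m + 1 := Nat.exists_eq_succ_of_ne_zero (NeZero.ne n)
  set S := {x : EuclideanSpace ℝ (Fin (m + 1)) | ∀ i, 0 < x i} with hSdef
  have hS : MeasurableSet S := by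
    simp only [hSdef, Set.setOf_forall]
    exact MeasurableSet.iInter fun i => measurableSet_lt (by fun_prop) (by fun_prop)
  set a := Finset.univ.inf' Finset.univ_nonempty A with ha
  have ha0 : 0 < a := by
    rw [ha, Finset.lt_inf'_iff]
    exact fun i _ => hA i
  have haA : ∀ i, a ≤ A i := fun i => Finset.inf'_le _ (Finset.mem_univ i)
  have hP : ∀ x ∈ S, 0 ≤ ∏ i, x i ^ A i := fun x hx =>
    Finset.prod_nonneg fun i _ => Real.rpow_nonneg (hx i).le _
  have hPc : Continuous fun x : EuclideanSpace ℝ (Fin (m + 1)) => ∏ i, x i ^ A i :=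
    continuous_finsetProd _ fun i _ =>
      Continuous.rpow_const (by fun_prop) fun x => Or.inr (hA i).le
  have hgc : Continuous (gradient u) :=
    (InnerProductSpace.toDual ℝ _).symm.continuous.comp (hu.continuous_fderiv (by norm_num))
  have hgs : HasCompactSupport (gradient u) :=
    (hsupp.fderiv ℝ).comp_left (g := (InnerProductSpace.toDual ℝ _).symm) (map_zero _)
  have hN0 : 0 ≤ ∫ x in S, (∏ i, x i ^ A i) * ‖gradient u x‖ :=
    setIntegral_nonneg hS fun x hx => mul_nonneg (hP x hx) (norm_nonneg _)
  have hNI : IntegrableOn (fun x => (∏ i, x i ^ A i) * ‖gradient u x‖) S :=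
    ((hPc.mul hgc.norm).integrable_of_hasCompactSupport hgs.norm.mul_left).integrableOn
  by_cases hF : IntegrableOn (fun x : EuclideanSpace ℝ (Fin (m + 1)) =>
    (∏ i, x i ^ A i) * u x * (∑ i, 1 / x i)) S
  swap
  · rw [integral_undef hF]
    refine mul_nonneg ?_ hN0
    rw [hK]
    positivity
  have hGI : ∀ i, IntegrableOn (fun x => (∏ j, x j ^ A j) * gradient u x i) S := fun i =>
    ((hPc.mul ((by fun_prop : Continuous fun v : EuclideanSpace ℝ (Fin (m + 1)) =>
      v i).comp hgc)).integrable_of_hasCompactSupport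
      (HasCompactSupport.mul_left (hgs.comp_left
        (g := fun v : EuclideanSpace ℝ (Fin (m + 1)) => v i) rfl))).integrableOn
  have hTI : ∀ i, IntegrableOn (fun x : EuclideanSpace ℝ (Fin (m + 1)) =>
      (∏ j, x j ^ A j) * u x * (1 / x i)) S := by
    intro i
    refine Integrable.mono' hF ?_ ?_
    · refine Measurable.aestronglyMeasurable ?_
      have := hPc.measurable
      have := hu.continuous.measurable
      fun_prop
    · filter_upwards [ae_restrict_mem hS] with x hx
      have h0 : ∀ j, 0 ≤ 1 / x j := fun j => (one_div_pos.2 (hx j)).le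
      have h1 := mul_nonneg (hP x hx) (hupos x)
      rw [Real.norm_of_nonneg (mul_nonneg h1 (h0 i))]
      exact mul_le_mul_of_nonneg_left
        (Finset.single_le_sum (f := fun j => 1 / x j) (fun j _ => h0 j) (Finset.mem_univ i)) h1
  have hsum : ∫ x in S, ∑ i, ((∏ j, x j ^ A j) * gradient u x i
      + A i * ((∏ j, x j ^ A j) * u x * (1 / x i))) = 0 := by
    refine (integral_finsetSum _ fun i _ => (hGI i).add ((hTI i).const_mul (A i))).trans ?_
    exact Finset.sum_eq_zero fun i _ => wh_coord i A hA u hu hsupp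
  have hle : ∫ x in S, (a * ((∏ i, x i ^ A i) * u x * (∑ i, 1 / x i))
      - Real.sqrt (m + 1 : ℕ) * ((∏ i, x i ^ A i) * ‖gradient u x‖)) ≤ 0 := by
    rw [← hsum]
    refine setIntegral_mono_on ((hF.const_mul _).sub (hNI.const_mul _))
      (integrable_finsetSum _ fun i _ => (hGI i).add ((hTI i).const_mul _)) hS ?_
    intro x hx
    have h1 := mul_nonneg (hP x hx) (hupos x)
    rw [Finset.sum_add_distrib, ← Finset.mul_sum]
    have e1 : a * ((∏ i, x i ^ A i) * u x * (∑ i, 1 / x i)) ≤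
        ∑ i, A i * ((∏ j, x j ^ A j) * u x * (1 / x i)) := by
      rw [Finset.mul_sum, Finset.mul_sum]
      exact Finset.sum_le_sum fun i _ => mul_le_mul_of_nonneg_right (haA i)
        (mul_nonneg h1 (one_div_pos.2 (hx i)).le)
    have e2 : -(∑ i, gradient u x i) ≤ Real.sqrt (m + 1 : ℕ) * ‖gradient u x‖ := by
      rw [EuclideanSpace.norm_eq, ← Real.sqrt_mul (by positivity)]
      apply Real.le_sqrt_of_sq_le
      have := sq_sum_le_card_mul_sum_sq (s := Finset.univ) (f := fun i => gradient u x i)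
      simpa using this
    have e3 := mul_le_mul_of_nonneg_left e2 (hP x hx)
    linarith
  rw [integral_sub (hF.const_mul _) (hNI.const_mul _), integral_const_mul,
    integral_const_mul] at hle
  rw [hK, div_mul_eq_mul_div, le_div_iff₀ ha0]
  linarith
end

section
/- Let α₁,...,αₙ ∈ [0,1) be real numbers, D = n + α₁/(1−α₁) + ⋯ + αₙ/(1−αₙ), 1 ≤ p < D, and p* = pD/(D−p). Then there is a constant C such that for all C¹ functions u with compact support in ℝⁿ, (∫_{ℝⁿ_*} |u|^{p*} dx)^{1/p*} ≤ C (∫_{ℝⁿ_*} (|x₁|^{pα₁}|u_{x₁}|^p + ⋯ + |xₙ|^{pαₙ}|u_{xₙ}|^p) dx)^{1/p}. -/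
open MeasureTheory Set Function Finset
open scoped ENNReal

lemma aux_int (a : ℝ) (ha : 0 < a) (t : ℝ) (ht : 0 < t) :
    ∫⁻ y in Set.Ioo 0 t, ENNReal.ofReal y ^ (a - 1) = ENNReal.ofReal (1 / a) * ENNReal.ofReal t ^ a := by
  have h1 : ∫⁻ y in Set.Ioo 0 t, ENNReal.ofReal y ^ (a - 1)
      = ∫⁻ y in Set.Ioo 0 t, ENNReal.ofReal (y ^ (a - 1)) := by
    refine setLIntegral_congr_fun measurableSet_Ioo ?_
    intro y hy
    exact ENNReal.ofReal_rpow_of_pos hy.1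
  rw [h1, ← ofReal_integral_eq_lintegral_ofReal, ← integral_Ioc_eq_integral_Ioo,
    ← intervalIntegral.integral_of_le ht.le, integral_rpow (Or.inl (by linarith)),
    ENNReal.ofReal_rpow_of_pos ht, ← ENNReal.ofReal_mul (by positivity)]
  · congr 1
    rw [sub_add_cancel, Real.zero_rpow ha.ne']
    ring
  · have := (intervalIntegral.intervalIntegrable_rpow' (a := 0) (b := t) (r := a - 1) (by linarith))
    rw [intervalIntegrable_iff_integrableOn_Ioo_of_le ht.le] at this
    exact this
  · filter_upwards [ae_restrict_mem measurableSet_Ioo] with y hy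
    exact Real.rpow_nonneg hy.1.le _

lemma meas_tail (μ : Measure ℝ) [SigmaFinite μ] (w : ℝ → ℝ≥0∞) (hw : Measurable w) :
    Measurable (fun y => ∫⁻ t, (Set.Ioi y).indicator w t ∂μ) := by
  apply Measurable.lintegral_prod_right'
    (f := fun z : ℝ × ℝ => (Set.Ioi z.1).indicator w z.2)
  have : (fun z : ℝ × ℝ => (Set.Ioi z.1).indicator w z.2)
      = ({z : ℝ × ℝ | z.1 < z.2}).indicator (fun z => w z.2) := by
    ext z; simp [Set.indicator]
  rw [this]
  exact (hw.comp measurable_snd).indicator (measurableSet_lt measurable_fst measurable_snd)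

lemma hardy (a : ℝ) (ha : 0 < a) (ha1 : a < 1) (w : ℝ → ℝ≥0∞) (hw : Measurable w) :
    ∫⁻ y in Set.Ioi (0:ℝ), (∫⁻ t in Set.Ioi (0:ℝ), (Set.Ioi y).indicator w t) ^ (1 / a)
      ≤ ENNReal.ofReal (1 / a) * (∫⁻ t in Set.Ioi (0:ℝ), ‖t‖ₑ ^ a * w t) ^ (1 / a) := by
  set W : ℝ → ℝ≥0∞ := fun y => ∫⁻ t in Set.Ioi (0:ℝ), (Set.Ioi y).indicator w t with hW
  set M := ∫⁻ t in Set.Ioi (0:ℝ), ‖t‖ₑ ^ a * w t with hM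
  have hWm : Measurable W := meas_tail _ w hw
  have h1a : 1 < 1 / a := by rw [lt_div_iff₀ ha]; linarith
  have key : ∀ y ∈ Set.Ioi (0:ℝ), W y ^ (1 / a) ≤
      M ^ (1 / a - 1) * (W y * ENNReal.ofReal y ^ (a - 1)) := by
    intro y hy
    have hy : 0 < y := hy
    have hy0 : ENNReal.ofReal y ≠ 0 := by simpa using hy
    have e1 : ENNReal.ofReal y ^ a * W y ≤ M := by
      rw [hW, hM]
      simp only
      rw [← lintegral_const_mul _ (hw.indicator measurableSet_Ioi)]
      apply lintegral_mono
      intro t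
      simp only [Set.indicator]
      split_ifs with h
      · have h : y < t := h
        gcongr
        rw [Real.enorm_eq_ofReal (by linarith)]
        exact ENNReal.ofReal_le_ofReal h.le
      · simp
    have e2 : W y ≤ M * ENNReal.ofReal y ^ (-a) := by
      calc W y = (ENNReal.ofReal y ^ a * W y) * ENNReal.ofReal y ^ (-a) := by
            rw [mul_right_comm, ← ENNReal.rpow_add _ _ hy0 ENNReal.ofReal_ne_top]
            simp
        _ ≤ _ := by gcongr
    calc W y ^ (1 / a) = W y ^ (1 / a - 1) * W y := by
          conv_rhs => rw [← ENNReal.rpow_one (W y), ← ENNReal.rpow_mul, one_mul,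
            ← ENNReal.rpow_add_of_nonneg _ _ (by linarith) (by norm_num)]
          congr 1; ring
      _ ≤ (M * ENNReal.ofReal y ^ (-a)) ^ (1 / a - 1) * W y := by
          gcongr
      _ = _ := by
          rw [ENNReal.mul_rpow_of_nonneg _ _ (by linarith), ← ENNReal.rpow_mul]
          have : -a * (1 / a - 1) = a - 1 := by field_simp; ring
          rw [this]; ring
  have fub : ∫⁻ y in Set.Ioi (0:ℝ), W y * ENNReal.ofReal y ^ (a - 1) = ENNReal.ofReal (1 / a) * M := by
    have : ∀ y, W y * ENNReal.ofReal y ^ (a - 1)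
        = ∫⁻ t in Set.Ioi (0:ℝ), ({z : ℝ × ℝ | z.1 < z.2}).indicator (fun z => w z.2 * ENNReal.ofReal z.1 ^ (a - 1)) (y, t) := by
      intro y
      rw [hW]
      simp only
      rw [← lintegral_mul_const _ (hw.indicator measurableSet_Ioi)]
      congr 1
      ext t
      simp [Set.indicator]
    simp_rw [this]
    rw [lintegral_lintegral_swap]
    · rw [hM, ← lintegral_const_mul _ (by fun_prop)]
      refine setLIntegral_congr_fun measurableSet_Ioi ?_
      intro t ht
      have ht : 0 < t := ht
      simp only
      have : ∀ y, ({z : ℝ × ℝ | z.1 < z.2}).indicator (fun z => w z.2 * ENNReal.ofReal z.1 ^ (a - 1)) (y, t)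
        = (Set.Iio t).indicator (fun y => w t * ENNReal.ofReal y ^ (a - 1)) y := by
        intro y; simp [Set.indicator]
      simp_rw [this]
      rw [lintegral_indicator measurableSet_Iio, Measure.restrict_restrict measurableSet_Iio,
        lintegral_const_mul _ (by fun_prop), Set.Iio_inter_Ioi, aux_int a ha t ht,
        Real.enorm_eq_ofReal ht.le]
      ring
    · apply Measurable.aemeasurable
      exact Measurable.indicator (by fun_prop) (measurableSet_lt measurable_fst measurable_snd)
  calc _ ≤ ∫⁻ y in Set.Ioi (0:ℝ), M ^ (1 / a - 1) * (W y * ENNReal.ofReal y ^ (a - 1)) :=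
        setLIntegral_mono' measurableSet_Ioi key
    _ = M ^ (1 / a - 1) * (ENNReal.ofReal (1 / a) * M) := by
        rw [lintegral_const_mul _ (by fun_prop), fub]
    _ = ENNReal.ofReal (1 / a) * (M ^ (1 / a - 1) * M ^ (1:ℝ)) := by
        rw [ENNReal.rpow_one]; ring
    _ = _ := by
        rw [← ENNReal.rpow_add_of_nonneg _ _ (by linarith) (by norm_num)]
        congr 2; ring

/-- one-dimensional measure -/
noncomputable def asMeas (a : ℝ) : Measure ℝ :=
  (volume : Measure ℝ).restrict (if 0 < a then Set.Ioi 0 else Set.univ)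

instance (a : ℝ) : SigmaFinite (asMeas a) := by unfold asMeas; infer_instance

lemma step1 {ι : Type*} (s : Finset ι) (a : ℝ) (ha : 0 ≤ a) (ha1 : a < 1) (G : ι → ℝ → ℝ≥0∞)
    (hG : ∀ i, Measurable (G i)) (w : ℝ → ℝ≥0∞) (hw : Measurable w) (θ : ι → ℝ)
    (hθ : ∀ i, 0 ≤ θ i) (b : ℝ) (hb : 0 ≤ b) (hs : a * b + ∑ i ∈ s, θ i = 1) :
    ∫⁻ y, (∫⁻ t, (Set.Ioi y).indicator w t ∂asMeas a) ^ b * ∏ i ∈ s, G i y ^ θ i ∂asMeas a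
      ≤ ENNReal.ofReal (1 / a) ^ (a * b) * ((∫⁻ t, ‖t‖ₑ ^ a * w t ∂asMeas a) ^ b *
        ∏ i ∈ s, (∫⁻ y, G i y ∂asMeas a) ^ θ i) := by
  rcases ha.eq_or_lt with rfl | ha
  · simp only [zero_mul, ENNReal.rpow_zero, one_mul]
    calc _ ≤ ∫⁻ y, (∫⁻ t, w t ∂asMeas 0) ^ b * ∏ i ∈ s, G i y ^ θ i ∂asMeas 0 := by
          gcongr with y t
          exact Set.indicator_le_self _ _ _
      _ = (∫⁻ t, w t ∂asMeas 0) ^ b * ∫⁻ y, ∏ i ∈ s, G i y ^ θ i ∂asMeas 0 := by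
          rw [lintegral_const_mul]
          exact Finset.measurable_fun_prod _ fun i _ => (hG i).pow_const _
      _ ≤ _ := by
          gcongr
          refine ENNReal.lintegral_prod_norm_pow_le s (fun i _ => (hG i).aemeasurable) ?_ fun i _ => hθ i
          simpa using hs
  · set W : ℝ → ℝ≥0∞ := fun y => ∫⁻ t, (Set.Ioi y).indicator w t ∂asMeas a with hW
    have hWm : Measurable W := meas_tail _ w hw
    calc _ = ∫⁻ y, (W y ^ (1 / a)) ^ (a * b) * ∏ i ∈ s, G i y ^ θ i ∂asMeas a := by
          congr with y
          rw [← ENNReal.rpow_mul]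
          congr 2
          field_simp
      _ ≤ (∫⁻ y, W y ^ (1 / a) ∂asMeas a) ^ (a * b) * ∏ i ∈ s, (∫⁻ y, G i y ∂asMeas a) ^ θ i := by
          refine ENNReal.lintegral_mul_prod_norm_pow_le s (hWm.pow_const _).aemeasurable (fun i _ => (hG i).aemeasurable) _ ?_ (by positivity) fun i _ => hθ i
          simpa using hs
      _ ≤ (ENNReal.ofReal (1 / a) * (∫⁻ t, ‖t‖ₑ ^ a * w t ∂asMeas a) ^ (1 / a)) ^ (a * b) * ∏ i ∈ s, (∫⁻ y, G i y ∂asMeas a) ^ θ i := by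
          gcongr
          have := hardy a ha ha1 w hw
          simpa [hW, asMeas, ha] using this
      _ = _ := by
          rw [ENNReal.mul_rpow_of_nonneg _ _ (by positivity), ← ENNReal.rpow_mul, mul_assoc]
          congr 4
          field_simp

section Step2
variable {ι : Type*} [Fintype ι] [DecidableEq ι]

noncomputable def tailF (α : ι → ℝ) (w : ι → (ι → ℝ) → ℝ≥0∞) (i : ι) (x : ι → ℝ) : ℝ≥0∞ :=
  ∫⁻ t, (Set.Ioi (x i)).indicator (fun t => w i (update x i t)) t ∂asMeas (α i)

lemma meas_tailF (α : ι → ℝ) (w : ι → (ι → ℝ) → ℝ≥0∞) (hw : ∀ i, Measurable (w i)) (i : ι) :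
    Measurable (tailF α w i) := by
  unfold tailF
  apply Measurable.lintegral_prod_right'
    (f := fun z : (ι → ℝ) × ℝ => (Set.Ioi (z.1 i)).indicator (fun t => w i (update z.1 i t)) z.2)
  have : (fun z : (ι → ℝ) × ℝ => (Set.Ioi (z.1 i)).indicator (fun t => w i (update z.1 i t)) z.2)
      = ({z : (ι → ℝ) × ℝ | z.1 i < z.2}).indicator (fun z => w i (update z.1 i z.2)) := by
    ext z; simp [Set.indicator]
  rw [this]
  refine Measurable.indicator ((hw i).comp ?_) (measurableSet_lt (by fun_prop) measurable_snd)
  exact measurable_update'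

lemma marg_tail (α : ι → ℝ) (w : ι → (ι → ℝ) → ℝ≥0∞) (hw : ∀ i, Measurable (w i)) (j : ι)
    (S : Finset ι) (hj : j ∉ S) (x : ι → ℝ) (y : ℝ) :
    lmarginal (fun i => asMeas (α i)) S (tailF α w j) (update x j y) =
      ∫⁻ t, (Set.Ioi y).indicator
        (fun t => lmarginal (fun i => asMeas (α i)) S (w j) (update x j t)) t ∂asMeas (α j) := by
  have hupd : ∀ z t, update (updateFinset (update x j y) S z) j t = updateFinset (update x j t) S z := by
    intro z t
    ext k
    by_cases hk : k = j
    · subst hk; simp [updateFinset, hj]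
    · simp [updateFinset, hk]
  have hyy : ∀ z, updateFinset (update x j y) S z j = y := by
    intro z; simp [updateFinset, hj]
  unfold lmarginal tailF
  simp_rw [hupd, hyy]
  rw [lintegral_lintegral_swap]
  · congr with t
    simp only [Set.indicator]
    split_ifs <;> simp
  · apply Measurable.aemeasurable
    have : (uncurry fun (z : (i : S) → ℝ) t => (Set.Ioi y).indicator (fun t => w j (updateFinset (update x j t) S z)) t)
      = ({z : ((i : S) → ℝ) × ℝ | y < z.2}).indicator (fun z => w j (updateFinset (update x j z.2) S z.1)) := by
      ext z; simp [Set.indicator, uncurry]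
    rw [this]
    refine Measurable.indicator ((hw j).comp ?_) (measurableSet_lt (by fun_prop) measurable_snd)
    rw [measurable_pi_iff]
    intro k
    by_cases hk : k ∈ S
    · simp only [updateFinset, hk, dite_true]; fun_prop
    · simp only [updateFinset, hk, dite_false]
      by_cases hkj : k = j
      · subst hkj; simp; fun_prop
      · simp [hkj]

noncomputable def HH (α : ι → ℝ) (w : ι → (ι → ℝ) → ℝ≥0∞) (S : Finset ι) (i : ι) : (ι → ℝ) → ℝ≥0∞ :=
  if i ∈ S then lmarginal (fun i => asMeas (α i)) S (fun x => ‖x i‖ₑ ^ α i * w i x)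
  else lmarginal (fun i => asMeas (α i)) S (tailF α w i)

lemma meas_HH (α : ι → ℝ) (w : ι → (ι → ℝ) → ℝ≥0∞) (hw : ∀ i, Measurable (w i)) (S : Finset ι) (i : ι) :
    Measurable (HH α w S i) := by
  unfold HH
  have := hw i
  split_ifs
  · exact Measurable.lmarginal _ (by fun_prop)
  · exact Measurable.lmarginal _ (meas_tailF α w hw i)

lemma step2 (α θ : ι → ℝ) (hα : ∀ i, 0 ≤ α i ∧ α i < 1) (hθ : ∀ i, 0 ≤ θ i)
    (hs : ∀ j, α j * θ j + ∑ i ∈ Finset.univ.erase j, θ i = 1)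
    (w : ι → (ι → ℝ) → ℝ≥0∞) (hw : ∀ i, Measurable (w i)) (S : Finset ι) :
    ∀ x, lmarginal (fun i => asMeas (α i)) S (fun x => ∏ i, tailF α w i x ^ θ i) x
      ≤ (∏ i ∈ S, ENNReal.ofReal (1 / α i) ^ (α i * θ i)) * ∏ i, HH α w S i x ^ θ i := by
  have hFm : Measurable (fun x => ∏ i, tailF α w i x ^ θ i) :=
    Finset.measurable_fun_prod _ fun i _ => (meas_tailF α w hw i).pow_const _
  induction S using Finset.induction with
  | empty => intro x; simp [HH]
  | insert j S hj ih =>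
    intro x
    rw [lmarginal_insert _ hFm hj]
    have hwj : Measurable (fun t => lmarginal (fun i => asMeas (α i)) S (w j) (update x j t)) :=
      (Measurable.lmarginal _ (hw j)).comp (measurable_update x)
    have hGm : ∀ i, Measurable fun y => HH α w S i (update x j y) := fun i =>
      (meas_HH α w hw S i).comp (measurable_update x)
    have h1 := step1 (Finset.univ.erase j) (α j) (hα j).1 (hα j).2 (fun i y => HH α w S i (update x j y)) hGm
      (fun t => lmarginal (fun i => asMeas (α i)) S (w j) (update x j t)) hwj θ hθ (θ j) (hθ j) (hs j)
    have hI : ∀ i ∈ Finset.univ.erase j, ∫⁻ y, HH α w S i (update x j y) ∂asMeas (α j) = HH α w (insert j S) i x := by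
      intro i hi
      have hij : i ≠ j := Finset.ne_of_mem_erase hi
      have := hw i
      by_cases hiS : i ∈ S
      · have : i ∈ insert j S := Finset.mem_insert_of_mem hiS
        simp only [HH, hiS, this, if_true]
        rw [lmarginal_insert _ (by fun_prop) hj]
      · have : i ∉ insert j S := by simp [hij, hiS]
        simp only [HH, hiS, this, if_false]
        rw [lmarginal_insert _ (meas_tailF α w hw i) hj]
    have hJ : ∫⁻ t, ‖t‖ₑ ^ α j * lmarginal (fun i => asMeas (α i)) S (w j) (update x j t) ∂asMeas (α j)
        = HH α w (insert j S) j x := by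
      have := hw j
      simp only [HH, Finset.mem_insert_self, if_true]
      rw [lmarginal_insert _ (by fun_prop) hj]
      congr with t
      unfold lmarginal
      have hm : Measurable fun z : (i : S) → ℝ => w j (updateFinset (update x j t) S z) :=
        this.comp measurable_updateFinset
      rw [← lintegral_const_mul _ hm]
      congr with z
      simp [updateFinset, hj]
    rw [hJ, Finset.prod_congr rfl (fun i hi => by rw [hI i hi])] at h1
    rw [Finset.mul_prod_erase _ (fun i => HH α w (insert j S) i x ^ θ i) (Finset.mem_univ j)] at h1
    have hK : ∀ y, ∏ i, HH α w S i (update x j y) ^ θ i =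
      (∫⁻ t, (Set.Ioi y).indicator (fun t => lmarginal (fun i => asMeas (α i)) S (w j) (update x j t)) t ∂asMeas (α j)) ^ θ j
        * ∏ i ∈ Finset.univ.erase j, HH α w S i (update x j y) ^ θ i := by
      intro y
      rw [← marg_tail α w hw j S hj x y,
        ← Finset.mul_prod_erase _ (fun i => HH α w S i (update x j y) ^ θ i) (Finset.mem_univ j)]
      simp only [HH, hj, if_false]
    calc _ ≤ ∫⁻ y, (∏ i ∈ S, ENNReal.ofReal (1 / α i) ^ (α i * θ i)) * ∏ i, HH α w S i (update x j y) ^ θ i ∂asMeas (α j) :=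
          lintegral_mono fun y => ih _
      _ = (∏ i ∈ S, ENNReal.ofReal (1 / α i) ^ (α i * θ i)) * ∫⁻ y, ∏ i, HH α w S i (update x j y) ^ θ i ∂asMeas (α j) := by
          rw [lintegral_const_mul]
          exact Finset.measurable_fun_prod _ fun i _ => (hGm i).pow_const _
      _ ≤ (∏ i ∈ S, ENNReal.ofReal (1 / α i) ^ (α i * θ i)) * (ENNReal.ofReal (1 / α j) ^ (α j * θ j) * ∏ i, HH α w (insert j S) i x ^ θ i) := by
          simp_rw [hK]
          gcongr
      _ = _ := by
          rw [Finset.prod_insert hj]; ring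

lemma step3 (α θ : ι → ℝ) (hα : ∀ i, 0 ≤ α i ∧ α i < 1) (hθ : ∀ i, 0 ≤ θ i)
    (hs : ∀ j, α j * θ j + ∑ i ∈ Finset.univ.erase j, θ i = 1)
    (w : ι → (ι → ℝ) → ℝ≥0∞) (hw : ∀ i, Measurable (w i)) :
    ∫⁻ x, ∏ i, tailF α w i x ^ θ i ∂Measure.pi (fun i => asMeas (α i))
      ≤ (∏ i, ENNReal.ofReal (1 / α i) ^ (α i * θ i)) *
        ∏ i, (∫⁻ x, ‖x i‖ₑ ^ α i * w i x ∂Measure.pi (fun i => asMeas (α i))) ^ θ i := by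
  have := step2 α θ hα hθ hs w hw Finset.univ 0
  simpa [HH] using this

lemma rpow_sum_aux (x : ℝ≥0∞) (θ : ι → ℝ) (hθ : ∀ i, 0 ≤ θ i) :
    x ^ (∑ i, θ i) = ∏ i, x ^ θ i := by
  classical
  have : ∀ s : Finset ι, x ^ (∑ i ∈ s, θ i) = ∏ i ∈ s, x ^ θ i := by
    intro s
    induction s using Finset.induction with
    | empty => simp
    | insert j s hj ih =>
      rw [Finset.sum_insert hj, Finset.prod_insert hj,
        ENNReal.rpow_add_of_nonneg _ _ (hθ j) (Finset.sum_nonneg fun i _ => hθ i), ih]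
  exact this _

/-- The case `p = 1`. -/
lemma sob1 (α : ι → ℝ) (hα : ∀ i, 0 ≤ α i ∧ α i < 1) (D : ℝ) (hD : D = ∑ i, 1 / (1 - α i))
    (hD1 : 1 < D) :
    ∃ K : ℝ≥0∞, K ≠ ∞ ∧ ∀ u : (ι → ℝ) → ℝ, ContDiff ℝ 1 u → HasCompactSupport u →
      ∫⁻ x, ‖u x‖ₑ ^ (D / (D - 1)) ∂Measure.pi (fun i => asMeas (α i)) ≤
        K * (∑ i, ∫⁻ x, ‖x i‖ₑ ^ α i * ‖fderiv ℝ u x (Pi.single i 1)‖ₑ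
          ∂Measure.pi (fun i => asMeas (α i))) ^ (D / (D - 1)) := by
  set θ : ι → ℝ := fun i => 1 / (1 - α i) / (D - 1) with hθdef
  have hpos : ∀ i, 0 < 1 - α i := fun i => by linarith [(hα i).2]
  have hθ : ∀ i, 0 ≤ θ i := fun i => by
    have := hpos i
    have : 0 < D - 1 := by linarith
    simp only [hθdef]; positivity
  have hθsum : ∑ i, θ i = D / (D - 1) := by
    rw [hD, Finset.sum_div, ← hD]
  have hs : ∀ j, α j * θ j + ∑ i ∈ Finset.univ.erase j, θ i = 1 := by
    intro j
    have h := Finset.add_sum_erase Finset.univ θ (Finset.mem_univ j)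
    rw [hθsum] at h
    have h2 : θ j * (1 - α j) = 1 / (D - 1) := by
      have := (hpos j).ne'
      simp only [hθdef]; field_simp
    have h3 : D / (D - 1) - 1 / (D - 1) = 1 := by
      rw [← sub_div, div_self]; linarith
    linarith
  refine ⟨∏ i, ENNReal.ofReal (1 / α i) ^ (α i * θ i), ?_, ?_⟩
  · apply ENNReal.prod_ne_top
    intro i _
    exact ENNReal.rpow_ne_top_of_nonneg (mul_nonneg (hα i).1 (hθ i)) ENNReal.ofReal_ne_top
  intro u hu h2u
  set w : ι → (ι → ℝ) → ℝ≥0∞ := fun i x => ‖fderiv ℝ u x (Pi.single i 1)‖ₑ with hwdef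
  have hcd : Continuous (fderiv ℝ u) := hu.continuous_fderiv one_ne_zero
  have hw : ∀ i, Measurable (w i) := fun i => by
    apply Continuous.measurable
    simp only [hwdef]
    fun_prop
  have hmem : ∀ᵐ x ∂Measure.pi (fun i => asMeas (α i)), ∀ i, 0 < α i → 0 < x i := by
    have : Measure.pi (fun i => asMeas (α i)) = (Measure.pi fun _ : ι => (volume : Measure ℝ)).restrict (Set.univ.pi fun i => if 0 < α i then Set.Ioi 0 else Set.univ) := by
      rw [Measure.restrict_pi_pi]; rfl
    rw [this]
    have hms : MeasurableSet (Set.univ.pi fun i => if 0 < α i then Set.Ioi (0:ℝ) else Set.univ) := by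
      apply MeasurableSet.univ_pi
      intro i; split_ifs <;> measurability
    filter_upwards [ae_restrict_mem hms] with x hx i hi
    have := hx i (Set.mem_univ i)
    simpa [hi] using this
  have hle : ∀ x : ι → ℝ, (∀ i, 0 < α i → 0 < x i) → ∀ i, ‖u x‖ₑ ≤ tailF α w i x := by
    intro x hx i
    have hc : ContDiff ℝ 1 (u ∘ update x i) := hu.comp (by convert! contDiff_update 1 x i)
    have hcs : HasCompactSupport (u ∘ update x i) := h2u.comp_isClosedEmbedding (isClosedEmbedding_update x i)
    have hder : ∀ y, deriv (u ∘ update x i) y = fderiv ℝ u (update x i y) (Pi.single i 1) := by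
      intro y
      rw [fderiv_comp_deriv _ (hu.differentiable one_ne_zero).differentiableAt
          (hasDerivAt_update x i y).differentiableAt, deriv_update]
    have h0 : ∫ t in Set.Ioi (x i), deriv (u ∘ update x i) t = - (u ∘ update x i) (x i) :=
      hcs.integral_Ioi_deriv_eq hc (x i)
    have h1 : ‖u x‖ₑ ≤ ∫⁻ t in Set.Ioi (x i), ‖deriv (u ∘ update x i) t‖ₑ := by
      have : ‖u x‖ₑ = ‖∫ t in Set.Ioi (x i), deriv (u ∘ update x i) t‖ₑ := by
        rw [h0]; simp
      rw [this]
      exact enorm_integral_le_lintegral_enorm _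
    refine h1.trans (le_of_eq ?_)
    simp_rw [hder]
    unfold tailF asMeas
    rw [lintegral_indicator measurableSet_Ioi, Measure.restrict_restrict measurableSet_Ioi]
    congr 2
    split_ifs with h
    · rw [Set.Ioi_inter_Ioi, sup_of_le_left (hx i h).le]
    · simp
  calc _ = ∫⁻ x, ∏ i, ‖u x‖ₑ ^ θ i ∂Measure.pi (fun i => asMeas (α i)) := by
        congr with x
        rw [← hθsum, rpow_sum_aux _ _ hθ]
    _ ≤ ∫⁻ x, ∏ i, tailF α w i x ^ θ i ∂Measure.pi (fun i => asMeas (α i)) := by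
        apply lintegral_mono_ae
        filter_upwards [hmem] with x hx
        gcongr with i
        · exact hθ i
        · exact hle x hx i
    _ ≤ _ := step3 α θ hα hθ hs w hw
    _ ≤ _ := by
        gcongr
        rw [← hθsum, rpow_sum_aux _ _ hθ]
        gcongr with i
        · exact hθ i
        · exact Finset.single_le_sum (f := fun i => ∫⁻ x, ‖x i‖ₑ ^ α i * ‖fderiv ℝ u x (Pi.single i 1)‖ₑ
          ∂Measure.pi (fun i => asMeas (α i))) (fun _ _ => zero_le) (Finset.mem_univ i)
end Step2

section Step3
variable {ι : Type*} [Fintype ι] [DecidableEq ι]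

lemma pi_asMeas (α : ι → ℝ) : Measure.pi (fun i => asMeas (α i)) =
    (volume : Measure (ι → ℝ)).restrict {x | ∀ i, 0 < α i → 0 < x i} := by
  have : {x : ι → ℝ | ∀ i, 0 < α i → 0 < x i} = Set.univ.pi fun i => if 0 < α i then Set.Ioi 0 else Set.univ := by
    ext x
    simp only [Set.mem_ofPred_eq, Set.mem_pi, Set.mem_univ, true_imp_iff]
    refine forall_congr' fun i => ?_
    split_ifs with h <;> simp [h]
  rw [this, volume_pi, Measure.restrict_pi_pi]; rfl

lemma fin_aux (α : ι → ℝ) (f : (ι → ℝ) → ℝ) (hf : Continuous f) (h2f : HasCompactSupport f) :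
    ∫⁻ x, ‖f x‖ₑ ∂Measure.pi (fun i => asMeas (α i)) ≠ ∞ := by
  rw [pi_asMeas]
  exact ((hf.integrable_of_hasCompactSupport (μ := volume) h2f).integrableOn).2.ne

lemma sobp (α : ι → ℝ) (hα : ∀ i, 0 ≤ α i ∧ α i < 1) (D : ℝ) (hD : D = ∑ i, 1 / (1 - α i))
    (p : ℝ) (hp1 : 1 ≤ p) (hpD : p < D) (q : ℝ) (hq : q = p * D / (D - p)) :
    ∃ K : ℝ≥0∞, K ≠ ∞ ∧ ∀ u : (ι → ℝ) → ℝ, ContDiff ℝ 1 u → HasCompactSupport u →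
      (∫⁻ x, ‖u x‖ₑ ^ q ∂Measure.pi (fun i => asMeas (α i))) ^ (1 / q) ≤
        K * (∑ i, ∫⁻ x, ‖x i‖ₑ ^ (p * α i) * ‖fderiv ℝ u x (Pi.single i 1)‖ₑ ^ p
          ∂Measure.pi (fun i => asMeas (α i))) ^ (1 / p) := by
  set μ := Measure.pi (fun i => asMeas (α i)) with hμ
  have hD1 : 1 < D := lt_of_le_of_lt hp1 hpD
  obtain ⟨K, hK, H⟩ := sob1 α hα D hD hD1
  have hDp : 0 < D - p := by linarith
  have hDm : 0 < D - 1 := by linarith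
  have hqpos : 0 < q := by rw [hq]; positivity
  rcases hp1.eq_or_lt with rfl | hp
  · refine ⟨K ^ (1 / q), ENNReal.rpow_ne_top_of_nonneg (by positivity) hK, fun u hu h2u => ?_⟩
    have := H u hu h2u
    have hq' : D / (D - 1) = q := by rw [hq]; ring
    rw [hq'] at this
    simp only [one_mul, ENNReal.rpow_one, div_one]
    calc _ ≤ _ := ENNReal.rpow_le_rpow this (by positivity)
      _ = _ := by
        rw [ENNReal.mul_rpow_of_nonneg _ _ (by positivity), ← ENNReal.rpow_mul, mul_one_div_cancel hqpos.ne',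
          ENNReal.rpow_one]
  set r := D / (D - 1) with hr
  have hrpos : 0 < r := by positivity
  set γ := p * (D - 1) / (D - p) with hγ
  have hγ1 : 1 < γ := by
    rw [hγ, one_lt_div hDp]; nlinarith
  set p' := Real.conjExponent p with hp'
  have hpp : p.HolderConjugate p' := .conjExponent hp
  have hp'pos : 0 < p' := hpp.symm.pos
  have e1 : γ * r = q := by rw [hγ, hr, hq]; field_simp
  have e2 : (γ - 1) * p' = q := by
    rw [hγ, hq, hpp.conjugate_eq]
    have : p - 1 ≠ 0 := by linarith
    field_simp; ring
  have e3 : 1 / r - 1 / p' = 1 / q := by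
    rw [hr, hq, hpp.conjugate_eq]
    have : p - 1 ≠ 0 := by linarith
    field_simp; ring
  refine ⟨K ^ (1 / r) * (ENNReal.ofReal γ * (Fintype.card ι : ℝ≥0∞)), by finiteness, fun u hu h2u => ?_⟩
  set A := ∫⁻ x, ‖u x‖ₑ ^ q ∂μ with hA
  set B : ι → ℝ≥0∞ := fun i => ∫⁻ x, ‖x i‖ₑ ^ (p * α i) * ‖fderiv ℝ u x (Pi.single i 1)‖ₑ ^ p ∂μ with hB
  have huc : Continuous u := hu.continuous
  have hcd : Continuous (fderiv ℝ u) := hu.continuous_fderiv one_ne_zero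
  have hAtop : A ≠ ∞ := by
    have := fin_aux α (fun x => ‖u x‖ ^ q) (by
      exact huc.norm.rpow_const fun x => Or.inr hqpos.le) (h2u.norm.rpow_const hqpos.ne')
    convert this using 2
    congr with x
    rw [Real.enorm_rpow_of_nonneg (norm_nonneg _) hqpos.le]
    simp
  by_cases hA0 : A = 0
  · rw [hA0, ENNReal.zero_rpow_of_pos (by positivity)]; exact zero_le
  have hv := H (fun x => ‖u x‖ ^ γ) (hu.norm_rpow hγ1) (h2u.norm.rpow_const (by linarith))
  have hL : ∀ x, ‖‖u x‖ ^ γ‖ₑ ^ r = ‖u x‖ₑ ^ q := by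
    intro x
    rw [Real.enorm_rpow_of_nonneg (norm_nonneg _) (by linarith), ← ENNReal.rpow_mul, e1]
    simp
  simp_rw [hL] at hv
  have hder : ∀ x i, ‖fderiv ℝ (fun x => ‖u x‖ ^ γ) x (Pi.single i 1)‖ₑ
      ≤ ENNReal.ofReal γ * (‖u x‖ₑ ^ (γ - 1) * ‖fderiv ℝ u x (Pi.single i 1)‖ₑ) := by
    intro x i
    have h1 : HasFDerivAt (fun x => ‖u x‖ ^ γ) ((γ * ‖u x‖ ^ (γ - 2) * u x) • fderiv ℝ u x) x :=
      (hasDerivAt_norm_rpow (u x) hγ1).comp_hasFDerivAt x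
        ((hu.differentiable one_ne_zero) x).hasFDerivAt
    rw [h1.fderiv]
    simp only [smul_apply, smul_eq_mul, enorm_mul]
    rw [← mul_assoc, mul_assoc ‖γ‖ₑ, ← enorm_mul, Real.enorm_eq_ofReal (by linarith : 0 ≤ γ)]
    have : ‖‖u x‖ ^ (γ - 2) * u x‖ = ‖u x‖ ^ (γ - 1) := by
      rw [norm_mul, Real.norm_of_nonneg (by positivity)]
      by_cases h0 : ‖u x‖ = 0
      · rw [h0, Real.zero_rpow (x := γ - 1) (by linarith)]; simp
      · have h0' : 0 < ‖u x‖ := lt_of_le_of_ne (norm_nonneg _) (Ne.symm h0)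
        nth_rewrite 2 [← Real.rpow_one ‖u x‖]
        rw [← Real.rpow_add h0']
        congr 1; ring
    rw [← ofReal_norm_eq_enorm, this, ← ENNReal.ofReal_rpow_of_nonneg (norm_nonneg _) (by linarith),
      ofReal_norm_eq_enorm]
  have hterm : ∀ i, ∫⁻ x, ‖x i‖ₑ ^ α i * ‖fderiv ℝ (fun x => ‖u x‖ ^ γ) x (Pi.single i 1)‖ₑ ∂μ
      ≤ ENNReal.ofReal γ * (A ^ (1 / p') * B i ^ (1 / p)) := by
    intro i
    have hm1 : Measurable fun x : ι → ℝ => ‖u x‖ₑ ^ (γ - 1) := by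
      have := huc.measurable; fun_prop
    have hm2 : Measurable fun x : ι → ℝ => ‖x i‖ₑ ^ α i * ‖fderiv ℝ u x (Pi.single i 1)‖ₑ := by
      have : Continuous fun x => fderiv ℝ u x (Pi.single i 1) := by fun_prop
      have := this.measurable
      fun_prop
    calc _ ≤ ∫⁻ x, ENNReal.ofReal γ * ((fun x => ‖u x‖ₑ ^ (γ - 1)) *
            (fun x => ‖x i‖ₑ ^ α i * ‖fderiv ℝ u x (Pi.single i 1)‖ₑ)) x ∂μ := by
          apply lintegral_mono
          intro x
          simp only [Pi.mul_apply]
          calc _ ≤ ‖x i‖ₑ ^ α i * (ENNReal.ofReal γ * (‖u x‖ₑ ^ (γ - 1) * ‖fderiv ℝ u x (Pi.single i 1)‖ₑ)) := by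
                gcongr; exact hder x i
            _ = _ := by ring
      _ = ENNReal.ofReal γ * ∫⁻ x, ((fun x => ‖u x‖ₑ ^ (γ - 1)) *
            (fun x => ‖x i‖ₑ ^ α i * ‖fderiv ℝ u x (Pi.single i 1)‖ₑ)) x ∂μ :=
          lintegral_const_mul _ (hm1.mul hm2)
      _ ≤ _ := by
          gcongr
          refine (ENNReal.lintegral_mul_le_Lp_mul_Lq μ hpp.symm hm1.aemeasurable hm2.aemeasurable).trans (le_of_eq ?_)
          congr 2
          · rw [hA]
            congr with x
            rw [← ENNReal.rpow_mul, e2]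
          · rw [hB]
            congr with x
            rw [ENNReal.mul_rpow_of_nonneg _ _ (by linarith), ← ENNReal.rpow_mul, mul_comm p]
  have hsum : ∑ i, ∫⁻ x, ‖x i‖ₑ ^ α i * ‖fderiv ℝ (fun x => ‖u x‖ ^ γ) x (Pi.single i 1)‖ₑ ∂μ
      ≤ A ^ (1 / p') * (ENNReal.ofReal γ * (Fintype.card ι : ℝ≥0∞) * (∑ i, B i) ^ (1 / p)) := by
    calc _ ≤ ∑ i : ι, ENNReal.ofReal γ * (A ^ (1 / p') * (∑ i, B i) ^ (1 / p)) := by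
          refine Finset.sum_le_sum fun i _ => (hterm i).trans ?_
          gcongr
          exact Finset.single_le_sum (f := B) (fun _ _ => zero_le) (Finset.mem_univ i)
      _ = _ := by
          rw [Finset.sum_const, Finset.card_univ, nsmul_eq_mul]; ring
  have hfin : A ^ (1 / r) ≤ A ^ (1 / p') * (K ^ (1 / r) * (ENNReal.ofReal γ * (Fintype.card ι : ℝ≥0∞)) * (∑ i, B i) ^ (1 / p)) := by
    calc A ^ (1 / r) ≤ (K * (∑ i, ∫⁻ x, ‖x i‖ₑ ^ α i * ‖fderiv ℝ (fun x => ‖u x‖ ^ γ) x (Pi.single i 1)‖ₑ ∂μ) ^ r) ^ (1 / r) :=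
          ENNReal.rpow_le_rpow hv (by positivity)
      _ = K ^ (1 / r) * (∑ i, ∫⁻ x, ‖x i‖ₑ ^ α i * ‖fderiv ℝ (fun x => ‖u x‖ ^ γ) x (Pi.single i 1)‖ₑ ∂μ) := by
          rw [ENNReal.mul_rpow_of_nonneg _ _ (by positivity), ← ENNReal.rpow_mul, mul_one_div_cancel hrpos.ne',
            ENNReal.rpow_one]
      _ ≤ K ^ (1 / r) * (A ^ (1 / p') * (ENNReal.ofReal γ * (Fintype.card ι : ℝ≥0∞) * (∑ i, B i) ^ (1 / p))) := by
          gcongr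
      _ = _ := by ring
  have hA1 : A ^ (1 / p') ≠ 0 := (ENNReal.rpow_pos (pos_iff_ne_zero.mpr hA0) hAtop).ne'
  have hA2 : A ^ (1 / p') ≠ ∞ := ENNReal.rpow_ne_top_of_nonneg (by positivity) hAtop
  rw [← ENNReal.mul_le_mul_iff_right hA1 hA2, ← ENNReal.rpow_add _ _ hA0 hAtop, ← e3]
  convert hfin using 2
  ring
end Step3

/-- Sobolev inequality with anisotropic weights `|xᵢ|^{pαᵢ}` on each partial derivative. -/
theorem anisotropic_sobolev (n : ℕ) (α : Fin n → ℝ) (hα : ∀ i, 0 ≤ α i ∧ α i < 1)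
    (D : ℝ) (hD : D = n + ∑ i, α i / (1 - α i))
    (p : ℝ) (hp1 : 1 ≤ p) (hpD : p < D) (pStar : ℝ) (hpStar : pStar = p * D / (D - p))
    (Rstar : Set (EuclideanSpace ℝ (Fin n)))
    (hRstar : Rstar = {x | ∀ i, 0 < α i → 0 < x i}) :
    ∃ C : ℝ, ∀ u : EuclideanSpace ℝ (Fin n) → ℝ, ContDiff ℝ 1 u →
      HasCompactSupport u →
      (∫ x in Rstar, |u x| ^ pStar) ^ (1 / pStar)
        ≤ C * (∫ x in Rstar, ∑ i, |x i| ^ (p * α i) * |gradient u x i| ^ p) ^ (1 / p) := by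
  have hD' : D = ∑ i, 1 / (1 - α i) := by
    have : ∀ i, 1 / (1 - α i) = 1 + α i / (1 - α i) := by
      intro i
      have : 1 - α i ≠ 0 := by linarith [(hα i).2]
      field_simp; ring
    simp_rw [this, Finset.sum_add_distrib]
    simp [hD]
  have hqpos : 0 < pStar := by
    have : 0 < D - p := by linarith
    have : 0 < D := by linarith
    rw [hpStar]; positivity
  obtain ⟨K, hK, H⟩ := sobp α hα D hD' p hp1 hpD pStar hpStar
  refine ⟨K.toReal, fun u hu h2u => ?_⟩
  let L : (Fin n → ℝ) ≃L[ℝ] EuclideanSpace ℝ (Fin n) := (EuclideanSpace.equiv (Fin n) ℝ).symm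
  set v : (Fin n → ℝ) → ℝ := fun y => u (WithLp.toLp 2 y) with hvdef
  have hvL : v = u ∘ L := rfl
  have hv : ContDiff ℝ 1 v := by rw [hvL]; exact hu.comp L.contDiff
  have h2v : HasCompactSupport v := by rw [hvL]; exact h2u.comp_homeomorph L.toHomeomorph
  have hgrad : ∀ (y : Fin n → ℝ) (i : Fin n), gradient u (WithLp.toLp 2 y) i = fderiv ℝ v y (Pi.single i 1) := by
    intro y i
    have h1 : fderiv ℝ v y = (fderiv ℝ u (L y)).comp (L : (Fin n → ℝ) →L[ℝ] EuclideanSpace ℝ (Fin n)) := by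
      rw [hvL, fderiv_comp _ (hu.differentiable one_ne_zero _) L.differentiableAt, L.fderiv]
    have h2 : inner ℝ (gradient u (WithLp.toLp 2 y)) (EuclideanSpace.single i (1:ℝ)) = fderiv ℝ u (L y) (EuclideanSpace.single i (1:ℝ)) := by
      unfold gradient
      rw [InnerProductSpace.toDual_symm_apply]
      rfl
    rw [EuclideanSpace.inner_single_right] at h2
    simp at h2
    rw [h2, h1]
    rfl
  set T : Set (Fin n → ℝ) := {x | ∀ i, 0 < α i → 0 < x i} with hT
  have hpre : (WithLp.toLp 2) ⁻¹' Rstar = T := by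
    rw [hRstar]; rfl
  have htr : ∀ f : EuclideanSpace ℝ (Fin n) → ℝ, ∫ x in Rstar, f x = ∫ y in T, f (WithLp.toLp 2 y) := by
    intro f
    rw [← hpre]
    exact ((PiLp.volume_preserving_toLp (Fin n)).setIntegral_preimage_emb
      (MeasurableEquiv.toLp 2 (Fin n → ℝ)).measurableEmbedding f Rstar).symm
  rw [htr, htr]
  simp_rw [hgrad]
  have hvc : Continuous v := hv.continuous
  have hcd : Continuous (fderiv ℝ v) := hv.continuous_fderiv one_ne_zero
  have hcA : Continuous fun y => |v y| ^ pStar := hvc.abs.rpow_const fun x => Or.inr hqpos.le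
  have hcB : ∀ i, Continuous fun y : Fin n → ℝ => |y i| ^ (p * α i) * |fderiv ℝ v y (Pi.single i 1)| ^ p := by
    intro i
    refine Continuous.mul ?_ ?_
    · exact (continuous_apply i).abs.rpow_const fun x => Or.inr (mul_nonneg (by linarith) (hα i).1)
    · refine Continuous.rpow_const (by fun_prop) fun x => Or.inr (by linarith)
  have hsB : ∀ i, HasCompactSupport fun y : Fin n → ℝ => |y i| ^ (p * α i) * |fderiv ℝ v y (Pi.single i 1)| ^ p := by
    intro i
    refine HasCompactSupport.mul_left ?_
    exact (h2v.fderiv ℝ).comp_left (g := fun l : (Fin n → ℝ) →L[ℝ] ℝ => |l (Pi.single i 1)| ^ p)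
      (by simp [Real.zero_rpow (by linarith : p ≠ 0)])
  have hA : ∫ y in T, |u (WithLp.toLp 2 y)| ^ pStar = (∫⁻ x, ‖v x‖ₑ ^ pStar ∂Measure.pi (fun i => asMeas (α i))).toReal := by
    rw [pi_asMeas, integral_eq_lintegral_of_nonneg_ae (Filter.Eventually.of_forall fun x => by positivity) hcA.aestronglyMeasurable]
    congr 2 with x
    rw [← ENNReal.ofReal_rpow_of_nonneg (abs_nonneg _) hqpos.le, Real.enorm_eq_ofReal_abs]
  have hterm : ∀ (x : Fin n → ℝ) i, ENNReal.ofReal (|x i| ^ (p * α i) * |fderiv ℝ v x (Pi.single i 1)| ^ p)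
      = ‖x i‖ₑ ^ (p * α i) * ‖fderiv ℝ v x (Pi.single i 1)‖ₑ ^ p := by
    intro x i
    rw [ENNReal.ofReal_mul (by positivity),
      ← ENNReal.ofReal_rpow_of_nonneg (abs_nonneg _) (mul_nonneg (by linarith) (hα i).1),
      ← ENNReal.ofReal_rpow_of_nonneg (abs_nonneg _) (by linarith),
      Real.enorm_eq_ofReal_abs, Real.enorm_eq_ofReal_abs]
  have hB : ∫ y in T, ∑ i, |y i| ^ (p * α i) * |fderiv ℝ v y (Pi.single i 1)| ^ p
      = (∑ i, ∫⁻ x, ‖x i‖ₑ ^ (p * α i) * ‖fderiv ℝ v x (Pi.single i 1)‖ₑ ^ p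
          ∂Measure.pi (fun i => asMeas (α i))).toReal := by
    rw [pi_asMeas, integral_eq_lintegral_of_nonneg_ae (Filter.Eventually.of_forall fun x => by positivity)
      (continuous_finsetSum _ fun i _ => hcB i).aestronglyMeasurable]
    rw [← lintegral_finsetSum']
    · congr 2 with x
      rw [ENNReal.ofReal_sum_of_nonneg (fun i _ => by positivity)]
      simp_rw [hterm]
    · intro i _
      simp_rw [← hterm]
      exact (hcB i).measurable.ennreal_ofReal.aemeasurable
  have hBtop : (∑ i, ∫⁻ x, ‖x i‖ₑ ^ (p * α i) * ‖fderiv ℝ v x (Pi.single i 1)‖ₑ ^ p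
          ∂Measure.pi (fun i => asMeas (α i))) ≠ ∞ := by
    refine ENNReal.sum_ne_top.2 fun i _ => ?_
    have := fin_aux α _ (hcB i) (hsB i)
    convert this using 2
    congr with x
    rw [← hterm, Real.enorm_eq_ofReal (by positivity)]
  rw [hA]
  change _ ≤ K.toReal * (∫ y in T, ∑ i, |y i| ^ (p * α i) * |fderiv ℝ v y (Pi.single i 1)| ^ p) ^ (1 / p)
  rw [hB, ENNReal.toReal_rpow, ENNReal.toReal_rpow, ← ENNReal.toReal_mul]
  refine ENNReal.toReal_mono ?_ (H v hv h2v)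
  exact ENNReal.mul_ne_top hK (ENNReal.rpow_ne_top_of_nonneg (by positivity) hBtop)
end
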